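/- arXiv:1501.03602 — 5 statements merged into one kernel-verified Lean document; each statement's English description precedes it below -/
import Mathlib

section
/- Let x, y, z be words over an alphabet A and let i, j, k ≥ 1 and m ≥ 2 be integers. If (yx)^i · yx · (xxy)^j · xy · (xy)^k = z^m, then the words x, y, z pairwise commute (the equation has only periodic solutions). -/
namespace WordPower

variable {A : Type*}

/-- The images of the two letters of a binary alphabet. -/
def blk (x y : List A) : Bool → List A
  | true => x
  | false => y

theorem flatMap_blk_map_not (x y : List A) (l : List Bool) :
    (l.map not).flatMap (blk y x) = l.flatMap (blk x y) := by
  induction l with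
  | nil => rfl
  | cons b l ih => cases b <;> simp [blk, ih]

theorem flatMap_blk_append (x y : List A) (l : List Bool) :
    l.flatMap (blk x (x ++ y)) = (l.flatMap (blk [true] [true, false])).flatMap (blk x y) := by
  induction l with
  | nil => rfl
  | cons b l ih => cases b <;> simp [blk, ih]

theorem comm_of_relation_aux (N : ℕ) : ∀ (x y : List A) (l₁ l₂ : List Bool),
    x.length + y.length ≤ N → x ++ l₁.flatMap (blk x y) = y ++ l₂.flatMap (blk x y) →
    x ++ y = y ++ x := by
  induction N with
  | zero =>
    intro x y l₁ l₂ h _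
    have hx : x = [] := List.length_eq_zero_iff.1 (by omega)
    simp [hx]
  | succ N ih =>
    have key : ∀ (x y : List A) (l₁ l₂ : List Bool), x.length ≤ y.length →
        x.length + y.length ≤ N + 1 →
        x ++ l₁.flatMap (blk x y) = y ++ l₂.flatMap (blk x y) → x ++ y = y ++ x := by
      intro x y l₁ l₂ hle hN h
      rcases List.eq_nil_or_concat x with rfl | hx
      · simp
      have hx : 0 < x.length := by
        obtain ⟨a, b, rfl⟩ := hx; simp
      obtain ⟨y', rfl⟩ : x <+: y :=
        List.prefix_of_prefix_length_le ⟨_, h⟩ ⟨_, rfl⟩ hle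
      rw [List.append_assoc, List.append_cancel_left_eq] at h
      have hcomm : x ++ y' = y' ++ x := by
        rw [flatMap_blk_append, flatMap_blk_append] at h
        rcases l₁ with _ | ⟨b, l₁⟩
        · have : y' = [] := by
            have := congrArg List.length h
            simp at this
            exact List.length_eq_zero_iff.1 (by omega)
          simp [this]
        · simp only [List.length_append] at hN
          cases b
          · refine ih x y' (false :: l₁.flatMap (blk [true] [true, false]))
              (l₂.flatMap (blk [true] [true, false])) (by omega) ?_
            simpa [blk] using h
          · refine ih x y' (l₁.flatMap (blk [true] [true, false]))
              (l₂.flatMap (blk [true] [true, false])) (by omega) ?_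
            simpa [blk] using h
      rw [List.append_assoc, hcomm]
    intro x y l₁ l₂ hN h
    rcases le_total x.length y.length with hle | hle
    · exact key x y l₁ l₂ hle hN h
    · refine (key y x (l₂.map not) (l₁.map not) hle (by omega) ?_).symm
      rw [flatMap_blk_map_not, flatMap_blk_map_not, h]

/-- Two words satisfying a nontrivial relation commute. -/
theorem comm_of_relation {x y : List A} (l₁ l₂ : List Bool) (hne : l₁ ≠ l₂)
    (h : l₁.flatMap (blk x y) = l₂.flatMap (blk x y)) : x ++ y = y ++ x := by
  induction l₁ generalizing l₂ with
  | nil =>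
    rcases l₂ with _ | ⟨b, l₂⟩
    · exact absurd rfl hne
    · cases b <;> simp [blk] at h <;> simp [h.1]
  | cons a l₁ ih =>
    rcases l₂ with _ | ⟨b, l₂⟩
    · cases a <;> simp [blk] at h <;> simp [h.1]
    · cases a <;> cases b
      · exact ih l₂ (by simpa using hne) (by simpa [blk] using h)
      · exact comm_of_relation_aux _ x y l₂ l₁ le_rfl (by simpa [blk] using h.symm)
      · exact comm_of_relation_aux _ x y l₁ l₂ le_rfl (by simpa [blk] using h)
      · exact ih l₂ (by simpa using hne) (by simpa [blk] using h)

/-- The `k`-th power of a word. -/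
def rep (k : ℕ) (u : List A) : List A := (List.replicate k u).flatten

@[simp] theorem rep_zero (u : List A) : rep 0 u = [] := rfl

@[simp] theorem rep_succ (k : ℕ) (u : List A) : rep (k + 1) u = u ++ rep k u := by
  simp [rep, List.replicate_succ]

@[simp] theorem length_rep (k : ℕ) (u : List A) : (rep k u).length = k * u.length := by
  simp [rep]

theorem rep_add (j k : ℕ) (u : List A) : rep (j + k) u = rep j u ++ rep k u := by
  induction j with
  | zero => simp
  | succ j ih => rw [Nat.succ_add]; simp [ih]

theorem rep_rep (j k : ℕ) (u : List A) : rep j (rep k u) = rep (j * k) u := by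
  induction j with
  | zero => simp
  | succ j ih => rw [rep_succ, ih, ← rep_add]; congr 1; ring

theorem rep_eq_flatMap_true (k : ℕ) (x y : List A) :
    rep k x = (List.replicate k true).flatMap (blk x y) := by
  induction k with
  | zero => rfl
  | succ k ih => simp [List.replicate_succ, blk, ih]

theorem rep_eq_flatMap_false (k : ℕ) (x y : List A) :
    rep k y = (List.replicate k false).flatMap (blk x y) := by
  induction k with
  | zero => rfl
  | succ k ih => simp [List.replicate_succ, blk, ih]

theorem comm_rep {u v : List A} (h : u ++ v = v ++ u) (k : ℕ) :
    rep k u ++ v = v ++ rep k u := by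
  induction k with
  | zero => simp
  | succ k ih => rw [rep_succ, List.append_assoc, ih, ← List.append_assoc, h, List.append_assoc]

theorem comm_of_comm_rep {u v : List A} {k : ℕ} (hk : 1 ≤ k)
    (h : rep k u ++ v = v ++ rep k u) : u ++ v = v ++ u := by
  obtain ⟨k, rfl⟩ := Nat.exists_eq_add_of_le' hk
  refine comm_of_relation (List.replicate (k + 1) true ++ [false])
    ([false] ++ List.replicate (k + 1) true) (by simp [List.replicate_succ]) ?_
  rw [List.flatMap_append, List.flatMap_append, ← rep_eq_flatMap_true]
  simpa [blk] using h

theorem comm_append {u v w : List A} (hu : u ++ w = w ++ u) (hv : v ++ w = w ++ v) :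
    (u ++ v) ++ w = w ++ (u ++ v) := by
  rw [List.append_assoc, hv, ← List.append_assoc, hu, List.append_assoc]

theorem exists_common_root_aux (N : ℕ) : ∀ u v : List A, u.length + v.length ≤ N →
    u ++ v = v ++ u → ∃ θ i j, u = rep i θ ∧ v = rep j θ := by
  induction N with
  | zero =>
    intro u v h _
    exact ⟨[], 0, 0, List.length_eq_zero_iff.1 (by omega), List.length_eq_zero_iff.1 (by omega)⟩
  | succ N ih =>
    have key : ∀ u v : List A, u.length ≤ v.length → u.length + v.length ≤ N + 1 →
        u ++ v = v ++ u → ∃ θ i j, u = rep i θ ∧ v = rep j θ := by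
      intro u v hle hN h
      rcases u with _ | ⟨a, u⟩
      · exact ⟨v, 0, 1, by simp, by simp⟩
      obtain ⟨v', rfl⟩ : (a :: u) <+: v :=
        List.prefix_of_prefix_length_le ⟨_, h⟩ ⟨_, rfl⟩ hle
      rw [List.append_assoc, List.append_cancel_left_eq] at h
      obtain ⟨θ, i, j, hi, hj⟩ := ih (a :: u) v' (by simp at hN ⊢; omega) h
      exact ⟨θ, i, i + j, hi, by rw [rep_add, ← hi, ← hj]⟩
    intro u v hN h
    rcases le_total u.length v.length with hle | hle
    · exact key u v hle hN h
    · obtain ⟨θ, i, j, hi, hj⟩ := key v u hle (by omega) h.symm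
      exact ⟨θ, j, i, hj, hi⟩

theorem exists_common_root {u v : List A} (h : u ++ v = v ++ u) :
    ∃ θ i j, u = rep i θ ∧ v = rep j θ :=
  exists_common_root_aux _ u v le_rfl h

theorem comm_trans {u v w : List A} (hu : u ≠ []) (hv : u ++ v = v ++ u)
    (hw : u ++ w = w ++ u) : v ++ w = w ++ v := by
  obtain ⟨θ, i, j, hi, rfl⟩ := exists_common_root hv
  obtain ⟨i, rfl⟩ : ∃ i', i = i' + 1 := by
    rcases i with _ | i
    · exact absurd hi hu
    · exact ⟨i, rfl⟩
  have h₁ : θ ++ w = w ++ θ := comm_of_comm_rep (Nat.le_add_left 1 i) (hi ▸ hw)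
  exact comm_rep h₁ j

/-- A word is primitive if it is nonempty and is not equal to any of its proper rotations. -/
def Prim (u : List A) : Prop :=
  u ≠ [] ∧ ∀ a b, u = a ++ b → a ++ b = b ++ a → a = [] ∨ b = []

theorem exists_prim_root_aux (N : ℕ) : ∀ u : List A, u.length ≤ N → u ≠ [] →
    ∃ θ k, 1 ≤ k ∧ Prim θ ∧ u = rep k θ := by
  induction N with
  | zero =>
    intro u h hu
    exact absurd (List.length_eq_zero_iff.1 (by omega)) hu
  | succ N ih =>
    intro u hN hu
    by_cases hp : Prim u
    · exact ⟨u, 1, le_rfl, hp, by simp⟩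
    · simp only [Prim, not_and, not_forall, not_or] at hp
      obtain ⟨a, b, rfl, hab, ha, hb⟩ := hp hu
      obtain ⟨θ, i, j, rfl, rfl⟩ := exists_common_root hab
      have hi : 1 ≤ i := by
        rcases i with _ | i
        · exact absurd rfl ha
        · omega
      have hj : 1 ≤ j := by
        rcases j with _ | j
        · exact absurd rfl hb
        · omega
      have hθ : θ ≠ [] := by
        rintro rfl
        exact ha (List.length_eq_zero_iff.1 (by simp))
      have hθ' := List.length_pos_iff.2 hθ
      have : θ.length ≤ N := by
        simp only [List.length_append, length_rep] at hN
        nlinarith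
      obtain ⟨τ, k, hk, hτ, rfl⟩ := ih θ this hθ
      refine ⟨τ, (i + j) * k, Nat.mul_pos (by omega) hk, hτ, ?_⟩
      rw [← rep_add, rep_rep]

theorem exists_prim_root {u : List A} (hu : u ≠ []) : ∃ θ k, 1 ≤ k ∧ Prim θ ∧ u = rep k θ :=
  exists_prim_root_aux _ u le_rfl hu

/-- The factor of the two-sided infinite word `c` between positions `a` and `b`. -/
def slice (c : ℤ → A) (a b : ℤ) : List A := (List.range (b - a).toNat).map fun t : ℕ => c (a + t)

theorem length_slice (c : ℤ → A) (a b : ℤ) : (slice c a b).length = (b - a).toNat := by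
  simp [slice]

theorem slice_append (c : ℤ → A) {a b d : ℤ} (h₁ : a ≤ b) (h₂ : b ≤ d) :
    slice c a b ++ slice c b d = slice c a d := by
  obtain ⟨m, rfl⟩ := Int.le.dest h₁
  obtain ⟨k, rfl⟩ := Int.le.dest h₂
  have e₁ : (a + m - a).toNat = m := by omega
  have e₂ : (a + m + k - (a + m)).toNat = k := by omega
  have e₃ : (a + m + k - a).toNat = m + k := by omega
  simp only [slice, e₁, e₂, e₃, List.range_add, List.map_append, List.map_map]
  congr 1
  refine List.map_congr_left fun t _ => ?_
  simp [add_assoc]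

theorem slice_eq_iff (c c' : ℤ → A) {a b a' b' : ℤ} (h : b - a = b' - a') :
    slice c a b = slice c' a' b' ↔ ∀ t, 0 ≤ t → t < b - a → c (a + t) = c' (a' + t) := by
  unfold slice
  rw [← h]
  clear h
  constructor
  · intro H t h₀ h₁
    rw [List.map_inj_left] at H
    have := H t.toNat (by simp; omega)
    rwa [Int.toNat_of_nonneg h₀] at this
  · intro H
    refine List.map_congr_left fun t ht => H t (by omega) ?_
    simp at ht; omega

theorem slice_ne_nil (c : ℤ → A) {a b : ℤ} (h : a < b) : slice c a b ≠ [] := by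
  intro h₀
  have := congrArg List.length h₀
  rw [length_slice] at this
  simp at this; omega

/-- The word `u` occurs in `c` at position `q`. -/
def Occ (c : ℤ → A) (u : List A) (q : ℤ) : Prop := slice c q (q + u.length) = u

theorem Occ.same {c : ℤ → A} {u : List A} {q q' : ℤ} (h : Occ c u q) (h' : Occ c u q')
    {t : ℤ} (h₀ : 0 ≤ t) (h₁ : t < u.length) : c (q + t) = c (q' + t) :=
  (slice_eq_iff c c (by ring)).1 (h.trans h'.symm) t h₀ (by omega)

/-- Corresponding factors of two occurrences of the same word agree. -/
theorem Occ.slice_eq {c : ℤ → A} {u : List A} {q q' : ℤ} (h : Occ c u q) (h' : Occ c u q')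
    {a b a' b' : ℤ} (h₀ : q ≤ a) (h₁ : b ≤ q + u.length) (h₂ : a - q = a' - q')
    (h₃ : b - a = b' - a') : slice c a b = slice c a' b' := by
  rw [slice_eq_iff c c h₃]
  intro t ht₀ ht₁
  have := h.same h' (t := a - q + t) (by omega) (by omega)
  rwa [show q + (a - q + t) = a + t by ring, show q' + (a - q + t) = a' + t by omega] at this

theorem Occ.of_eq {c : ℤ → A} {u : List A} {q q' : ℤ} (h : Occ c u q) (e : q = q') : Occ c u q' :=
  e ▸ h

theorem Prim.align {c : ℤ → A} {L : List A} (hL : Prim L) {q q' : ℤ} (h : Occ c L q)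
    (h₁ : Occ c L (q + L.length)) (h' : Occ c L q') (h₂ : q ≤ q') (h₃ : q' ≤ q + L.length) :
    q' = q ∨ q' = q + L.length := by
  by_contra hne
  push Not at hne
  have e₁ : slice c (q + L.length) (q' + L.length) = slice c q q' :=
    h₁.slice_eq h le_rfl (by omega) (by omega) (by omega)
  have e₂ : L = slice c q q' ++ slice c q' (q + L.length) := by
    rw [slice_append c h₂ h₃]; exact h.symm
  have e₃ : L = slice c q' (q + L.length) ++ slice c q q' := by
    rw [← e₁, slice_append c h₃ (by omega)]; exact h'.symm
  rcases hL.2 _ _ e₂ (e₂.symm.trans e₃) with h | h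
  · exact slice_ne_nil c (by omega) h
  · exact slice_ne_nil c (by omega) h

/-- A Fine–Wilf type statement: long runs of two different periods contradict primitivity. -/
theorem Prim.no_shorter_period {c : ℤ → A} {L : List A} (hL : Prim L) {a q R s : ℤ}
    (h : Occ c L a) (hR : ∀ t, a ≤ t → t + L.length < R → c t = c (t + L.length))
    (hs : ∀ t, q ≤ t → t < q + L.length → c t = c (t + s)) (h₁ : a ≤ q) (h₂ : q ≤ a + L.length)
    (h₃ : q + s + L.length ≤ R) (h₄ : 0 < s) (h₅ : s < L.length) : False := by
  have key : ∀ t, a ≤ t → t < a + L.length → c t = c (t + s) := by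
    intro t ht₁ ht₂
    rcases lt_or_ge t q with ht | ht
    · rw [hR t ht₁ (by omega), hs _ (by omega) (by omega), hR (t + s) (by omega) (by omega)]
      congr 1; ring
    · exact hs t ht (by omega)
  have e₁ : L = slice c a (a + s) ++ slice c (a + s) (a + L.length) := by
    rw [slice_append c (by omega) (by omega)]; exact h.symm
  have e₂ : slice c (a + L.length) (a + s + L.length) = slice c a (a + s) := by
    symm
    rw [slice_eq_iff c c (by ring)]
    intro t ht₁ ht₂
    rw [hR _ (by omega) (by omega)]
    congr 1; ring
  have e₃ : L = slice c (a + s) (a + L.length) ++ slice c a (a + s) := by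
    rw [← e₂, slice_append c (by omega) (by omega)]
    refine h.symm.trans ?_
    rw [slice_eq_iff c c (by ring)]
    intro t ht₁ ht₂
    rw [key _ (by omega) (by omega)]
    congr 1; ring
  rcases hL.2 _ _ e₁ (e₁.symm.trans e₃) with h | h
  · exact slice_ne_nil c (by omega) h
  · exact slice_ne_nil c (by omega) h

/-- The text `c` is factored into the blocks `bl (T i)`, the `i`-th one starting at `pos i`. -/
structure Parse (c : ℤ → A) (bl : Bool → List A) (T : ℤ → Bool) (pos : ℤ → ℤ) : Prop where
  step : ∀ i, pos (i + 1) = pos i + (bl (T i)).length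
  occ : ∀ i, Occ c (bl (T i)) (pos i)
  ne : ∀ b, bl b ≠ []

namespace Parse

variable {c : ℤ → A} {bl : Bool → List A} {T : ℤ → Bool} {pos : ℤ → ℤ}

theorem pos_lt_succ (P : Parse c bl T pos) (i : ℤ) : pos i < pos (i + 1) := by
  have := List.length_pos_iff.2 (P.ne (T i))
  rw [P.step]; omega

theorem strictMono (P : Parse c bl T pos) : StrictMono pos :=
  strictMono_int_of_lt_succ P.pos_lt_succ

theorem locate (P : Parse c bl T pos) (q : ℤ) : ∃ k, pos k ≤ q ∧ q < pos (k + 1) := by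
  have up : ∀ n : ℕ, pos 0 + n ≤ pos n := by
    intro n
    induction n with
    | zero => simp
    | succ n ih => have := P.pos_lt_succ n; push_cast; omega
  have down : ∀ n : ℕ, pos (-n) ≤ pos 0 - n := by
    intro n
    induction n with
    | zero => simp
    | succ n ih =>
      have := P.pos_lt_succ (-(n + 1 : ℕ))
      rw [show (-((n + 1 : ℕ) : ℤ) + 1) = -n by push_cast; ring] at this
      push_cast at this ⊢; omega
  obtain ⟨k, hk, hmax⟩ := Int.exists_greatest_of_bdd (P := fun k => pos k ≤ q)
    ⟨(q - pos 0).toNat, fun k hk => by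
      by_contra! hlt
      have h₁ := P.strictMono hlt
      have h₂ := up (q - pos 0).toNat
      have h₃ : pos 0 ≤ pos ((q - pos 0).toNat : ℤ) := P.strictMono.monotone (by omega)
      have hk : pos k ≤ q := hk
      omega⟩
    ⟨-((pos 0 - q).toNat : ℤ), by
      have h₂ := down (pos 0 - q).toNat
      change pos _ ≤ q
      have h₃ : pos (-((pos 0 - q).toNat : ℤ)) ≤ pos 0 := P.strictMono.monotone (by omega)
      omega⟩
  refine ⟨k, hk, ?_⟩
  by_contra! hlt
  have := hmax _ hlt
  omega

/-- A run of equal blocks is periodic. -/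
theorem run (P : Parse c bl T pos) {k k' : ℤ} {b : Bool} (h : ∀ i, k ≤ i → i < k' → T i = b)
    {t : ℤ} (h₁ : pos k ≤ t) (h₂ : t + (bl b).length < pos k') : c t = c (t + (bl b).length) := by
  obtain ⟨i, hi₁, hi₂⟩ := P.locate t
  have hki : k ≤ i := by
    have := P.strictMono.lt_iff_lt.1 (h₁.trans_lt hi₂); omega
  have hik : i < k' := P.strictMono.lt_iff_lt.1 (by omega)
  have e := h i hki hik
  have s := P.step i
  rw [e] at s
  have hik' : i + 1 < k' := P.strictMono.lt_iff_lt.1 (by omega)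
  have o₁ := P.occ i
  have o₂ := P.occ (i + 1)
  rw [e] at o₁
  rw [h (i + 1) (by omega) hik', s] at o₂
  have := o₁.same o₂ (t := t - pos i) (by omega) (by omega)
  convert this using 2 <;> ring

end Parse

/-- A parsed text with a period `n` such that block boundaries never coincide with
shifted block boundaries. -/
structure DblParse (c : ℤ → A) (bl : Bool → List A) (T : ℤ → Bool) (pos : ℤ → ℤ) (n : ℤ) : Prop
    extends Parse c bl T pos where
  per : ∀ q, c (q + n) = c q
  disj : ∀ i k, pos k ≠ pos i + n

namespace DblParse

variable {c : ℤ → A} {bl : Bool → List A} {T : ℤ → Bool} {pos : ℤ → ℤ} {n : ℤ}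

theorem occ_shift (D : DblParse c bl T pos n) (i : ℤ) : Occ c (bl (T i)) (pos i + n) := by
  have := D.occ i
  unfold Occ at this ⊢
  refine Eq.trans ?_ this
  rw [slice_eq_iff c c (by ring)]
  intro t _ _
  rw [← D.per (pos i + t)]
  congr 1; ring

theorem run_shift (D : DblParse c bl T pos n) {k k' : ℤ} {b : Bool}
    (h : ∀ i, k ≤ i → i < k' → T i = b) {t : ℤ} (h₁ : pos k + n ≤ t)
    (h₂ : t + (bl b).length < pos k' + n) : c t = c (t + (bl b).length) := by
  have := D.run h (t := t - n) (by omega) (by omega)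
  rw [← D.per (t - n), ← D.per (t - n + (bl b).length)] at this
  convert this using 2 <;> ring

theorem locate_shift (D : DblParse c bl T pos n) (i : ℤ) :
    ∃ k, pos k < pos i + n ∧ pos i + n < pos (k + 1) := by
  obtain ⟨k, h₁, h₂⟩ := D.locate (pos i + n)
  exact ⟨k, lt_of_le_of_ne h₁ (D.disj i k), h₂⟩

end DblParse

theorem comm_cancel_left {u v w : List A} (h : (u ++ v) ++ w = w ++ (u ++ v))
    (hu : u ++ w = w ++ u) : v ++ w = w ++ v := by
  rw [← List.append_assoc, ← hu, List.append_assoc, List.append_assoc] at h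
  exact List.append_cancel_left h

theorem comm_cancel_right {u v w : List A} (h : (u ++ v) ++ w = w ++ (u ++ v))
    (hv : v ++ w = w ++ v) : u ++ w = w ++ u := by
  rw [List.append_assoc, hv, ← List.append_assoc, ← List.append_assoc] at h
  exact List.append_cancel_right h

theorem Parse.slice_comm {c : ℤ → A} {bl : Bool → List A} {T : ℤ → Bool} {pos : ℤ → ℤ}
    (P : Parse c bl T pos) {g : List A} {k k' : ℤ} (hk : k ≤ k')
    (h : ∀ i, k ≤ i → i < k' → bl (T i) ++ g = g ++ bl (T i)) :
    slice c (pos k) (pos k') ++ g = g ++ slice c (pos k) (pos k') := by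
  induction k', hk using Int.leInduction with
  | base => simp [slice]
  | succ j hj ih =>
    rw [← slice_append c (P.strictMono.monotone hj) (P.pos_lt_succ j).le]
    refine comm_append (ih fun i h₁ h₂ => h i h₁ (by omega)) ?_
    rw [P.step, P.occ j]
    exact h j hj (by omega)

theorem eq_not_of_ne {a b : Bool} (h : a ≠ b) : a = !b := by
  revert h; cases a <;> cases b <;> simp

namespace DblParse

variable {c : ℤ → A} {bl : Bool → List A} {T : ℤ → Bool} {pos : ℤ → ℤ} {n : ℤ}

/-- The longer block cannot occur three times in a row if it is primitive. -/
theorem false_of_cube (D : DblParse c bl T pos n) {b : Bool}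
    (hlt : (bl (!b)).length < (bl b).length) (hL : Prim (bl b))
    (hne : bl b ++ bl (!b) ≠ bl (!b) ++ bl b) {i : ℤ} (h₀ : T i = b) (h₁ : T (i + 1) = b)
    (h₂ : T (i + 2) = b) : False := by
  have hs : 0 < (bl (!b)).length := List.length_pos_iff.2 (D.ne _)
  have p₀ := D.step i
  have p₁ := D.step (i + 1)
  have p₂ := D.step (i + 2)
  rw [show i + 1 + 1 = i + 2 by ring] at p₁
  rw [show i + 2 + 1 = i + 3 by ring] at p₂
  have o₀ := D.occ_shift i
  have o₁ := D.occ_shift (i + 1)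
  have o₂ := D.occ_shift (i + 2)
  rw [h₀] at p₀ o₀
  rw [h₁] at p₁ o₁
  rw [h₂] at p₂ o₂
  have len : ∀ k, ((bl (T k)).length : ℤ) ≤ (bl b).length := by
    intro k
    rcases eq_or_ne (T k) b with h | h
    · rw [h]
    · rw [eq_not_of_ne h]; omega
  have hR : ∀ t, pos i + n ≤ t → t + (bl b).length < pos (i + 3) + n →
      c t = c (t + (bl b).length) := by
    intro t
    refine D.run_shift fun m hm₁ hm₂ => ?_
    obtain rfl | rfl | rfl : m = i ∨ m = i + 1 ∨ m = i + 2 := by omega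
    all_goals assumption
  obtain ⟨k₀, hk₀, hk₀'⟩ := D.locate_shift i
  obtain ⟨k₁, hk₁, hk₁'⟩ := D.locate_shift (i + 3)
  have inner : ∀ k, k₀ < k → k < k₁ → T k = !b := by
    intro k hk hk'
    by_contra hb
    have hb : T k = b := by
      by_contra h; exact hb (eq_not_of_ne h)
    have o := D.occ k
    have s := D.step k
    rw [hb] at o s
    have m₁ : pos (k₀ + 1) ≤ pos k := D.strictMono.monotone (by omega)
    have m₂ : pos (k + 1) ≤ pos k₁ := D.strictMono.monotone (by omega)
    have d₀ := D.disj i k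
    have d₁ := D.disj (i + 1) k
    have d₂ := D.disj (i + 2) k
    rcases le_total (pos k) (pos (i + 1) + n) with h | h
    · have := hL.align o₀ (o₁.of_eq (by omega)) o (by omega) (by omega)
      omega
    · have := hL.align o₁ (o₂.of_eq (by omega)) o (by omega) (by omega)
      omega
  have l₀ := len k₀
  have l₁ := len k₁
  have s₀ := D.step k₀
  have s₁ := D.step k₁
  have hkk : k₀ + 1 < k₁ := D.strictMono.lt_iff_lt.1 (by omega)
  have hS : ∀ t, pos (k₀ + 1) ≤ t → t + (bl (!b)).length < pos k₁ →
      c t = c (t + (bl (!b)).length) := fun t =>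
    D.run fun m hm₁ hm₂ => inner m (by omega) hm₂
  rcases le_or_gt (pos (k₀ + 1) + (bl b).length + (bl (!b)).length) (pos k₁) with hbig | hsmall
  · exact hL.no_shorter_period o₀ hR (fun t ht₁ ht₂ => hS t ht₁ (by omega)) (by omega) (by omega)
      (by omega) (by omega) (by omega)
  rcases ne_or_eq (T k₀) b with hT₀ | hT₀
  · have hT₀ := eq_not_of_ne hT₀
    refine hL.no_shorter_period (q := pos i + n) o₀ hR (fun t ht₁ ht₂ => ?_) (by omega) (by omega)
      (s := (bl (!b)).length) (by omega) (by omega) (by omega)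
    refine D.run (k := k₀) (k' := k₁) (fun m hm₁ hm₂ => ?_) (by omega) (by omega)
    rcases hm₁.eq_or_lt with rfl | h
    · exact hT₀
    · exact inner m h hm₂
  rcases ne_or_eq (T k₁) b with hT₁ | hT₁
  · have hT₁ := eq_not_of_ne hT₁
    refine hL.no_shorter_period (q := pos (k₀ + 1)) o₀ hR (fun t ht₁ ht₂ => ?_) (by omega)
      (by omega) (s := (bl (!b)).length) (by omega) (by omega) (by omega)
    refine D.run (k := k₀ + 1) (k' := k₁ + 1) (fun m hm₁ hm₂ => ?_) (by omega) (by omega)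
    rcases (Int.lt_add_one_iff.1 hm₂).eq_or_lt with rfl | h
    · exact hT₁
    · exact inner m (by omega) h
  have O₀ := D.occ k₀
  have O₁ := D.occ k₁
  have S₀ := D.occ (k₀ + 1)
  have S₁ := D.occ (k₁ - 1)
  have sS₁ := D.step (k₁ - 1)
  rw [show k₁ - 1 + 1 = k₁ by ring] at sS₁
  rw [inner (k₁ - 1) (by omega) (by omega)] at S₁ sS₁
  rw [inner (k₀ + 1) (by omega) (by omega)] at S₀
  rw [hT₀] at O₀ s₀
  rw [hT₁] at O₁
  have hqq : pos (k₀ + 1) ≤ pos (k₁ - 1) := D.strictMono.monotone (by omega)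
  generalize hℓ : ((bl b).length : ℤ) = ℓ at *
  generalize hσ : ((bl (!b)).length : ℤ) = s at *
  have hs' : 0 < s := by omega
  have hlt' : s < ℓ := by omega
  obtain ⟨a, ha⟩ : ∃ a, a = pos i + n := ⟨_, rfl⟩
  obtain ⟨q, hq⟩ : ∃ q, q = pos (k₀ + 1) := ⟨_, rfl⟩
  obtain ⟨q', hq'⟩ : ∃ q', q' = pos k₁ := ⟨_, rfl⟩
  obtain ⟨e₀, he₀⟩ : ∃ e, e = a + ℓ - q := ⟨_, rfl⟩
  obtain ⟨e₁, he₁⟩ : ∃ e, e = q' - a - 2 * ℓ := ⟨_, rfl⟩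
  have o₀ : Occ c (bl b) a := o₀.of_eq (by omega)
  have o₁ : Occ c (bl b) (a + ℓ) := o₁.of_eq (by omega)
  have o₂ : Occ c (bl b) (a + 2 * ℓ) := o₂.of_eq (by omega)
  have O₀ : Occ c (bl b) (q - ℓ) := O₀.of_eq (by omega)
  have O₁ : Occ c (bl b) q' := O₁.of_eq (by omega)
  have S₀ : Occ c (bl (!b)) q := S₀.of_eq (by omega)
  have S₁ : Occ c (bl (!b)) (q' - s) := S₁.of_eq (by omega)
  have hSg : bl (!b) = slice c (q' - s) (q' - s + e₀) ++ slice c (q' - s + e₀) (a + 2 * ℓ) ++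
      slice c (a + 2 * ℓ) q' := by
    rw [slice_append c (by omega) (by omega), slice_append c (by omega) (by omega)]
    refine S₁.symm.trans ?_
    rw [hσ]; congr 1; ring
  have c₁ : slice c (q' - s) (q' - s + e₀) ++ slice c (q' - s + e₀) (a + 2 * ℓ) =
      slice c (q' - s + e₀) (a + 2 * ℓ) ++ slice c (q' - s) (q' - s + e₀) := by
    have f₁ : slice c (q' - s) (q' - s + e₀) = slice c (a + 2 * ℓ - e₀) (a + 2 * ℓ) :=
      (S₁.slice_eq S₀ (a' := q) (b' := a + ℓ) (by omega) (by omega) (by omega) (by omega)).trans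
        (o₀.slice_eq o₁ (by omega) (by omega) (by omega) (by omega))
    have f₂ : slice c (q' - s + e₀) (a + 2 * ℓ) = slice c (q' - s) (a + 2 * ℓ - e₀) :=
      (o₁.slice_eq O₀ (a' := q' - s - ℓ) (b' := q) (by omega) (by omega) (by omega)
        (by omega)).trans (o₀.slice_eq o₁ (by omega) (by omega) (by omega) (by omega))
    rw [slice_append c (by omega) (by omega), f₂, f₁, slice_append c (by omega) (by omega)]
  have c₂ : slice c (a + 2 * ℓ) q' ++ slice c (q' - s + e₀) (a + 2 * ℓ) =
      slice c (q' - s + e₀) (a + 2 * ℓ) ++ slice c (a + 2 * ℓ) q' := by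
    have f₀ : slice c (q' - s + e₀) q' = slice c (a + ℓ) (q + s) :=
      S₁.slice_eq S₀ (by omega) (by omega) (by omega) (by omega)
    have f₁ : slice c (a + 2 * ℓ) q' = slice c (a + ℓ) (a + ℓ + e₁) :=
      o₂.slice_eq o₁ (by omega) (by omega) (by omega) (by omega)
    have f₂ : slice c (q' - s + e₀) (a + 2 * ℓ) = slice c (a + ℓ + e₁) (q + s) :=
      (S₁.slice_eq S₀ (a' := a + ℓ) (b' := 2 * a + 3 * ℓ - q' + s - e₀) (by omega) (by omega)
        (by omega) (by omega)).trans <|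
      (o₁.slice_eq O₁ (a' := q') (b' := q + s + ℓ) (by omega) (by omega)
        (by omega) (by omega)).trans (o₂.slice_eq o₁ (by omega) (by omega) (by omega) (by omega))
    rw [slice_append c (by omega) (by omega), f₀, f₁, f₂, slice_append c (by omega) (by omega)]
  have cS : bl (!b) ++ slice c (q' - s + e₀) (a + 2 * ℓ) =
      slice c (q' - s + e₀) (a + 2 * ℓ) ++ bl (!b) := by
    rw [hSg]
    exact comm_append (comm_append c₁ rfl) c₂
  have cL := D.slice_comm (k := k₀ + 1) (k' := k₁) (g := slice c (q' - s + e₀) (a + 2 * ℓ))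
    (by omega) fun m hm₁ hm₂ => by rw [inner m (by omega) hm₂]; exact cS
  rw [← hq, ← hq', ← slice_append c (b := a + 2 * ℓ) (by omega) (by omega)] at cL
  have cL := comm_cancel_right cL c₂
  rw [← slice_append c (b := a + ℓ) (by omega) (by omega)] at cL
  have cL := comm_cancel_left cL (by
    rw [← S₁.slice_eq S₀ (a := q' - s) (b := q' - s + e₀) (by omega) (by omega) (by omega)
      (by omega)]
    exact c₁)
  have e : slice c (a + ℓ) (a + 2 * ℓ) = bl b := by
    refine Eq.trans ?_ o₁
    rw [hℓ]; congr 1; ring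
  rw [e] at cL
  exact hne (comm_trans (slice_ne_nil c (by omega)) cL.symm cS.symm)

end DblParse

theorem Occ.slice_take {c : ℤ → A} {u : List A} {q : ℤ} (h : Occ c u q) {d : ℕ}
    (hd : d ≤ u.length) : slice c q (q + d) = u.take d := by
  unfold Occ at h
  rw [← slice_append c (b := q + d) (by omega) (by omega)] at h
  conv_rhs => rw [← h]
  rw [List.take_left' (by simp [length_slice])]

theorem Occ.slice_drop {c : ℤ → A} {u : List A} {q : ℤ} (h : Occ c u q) {d : ℕ}
    (hd : d ≤ u.length) : slice c (q + d) (q + u.length) = u.drop d := by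
  unfold Occ at h
  rw [← slice_append c (b := q + d) (by omega) (by omega)] at h
  conv_rhs => rw [← h]
  rw [List.drop_left' (by simp [length_slice])]

/-- If `u² v = v u²` then `u v = v u`. -/
theorem comm_of_sq_comm {u v : List A} (h : u ++ (u ++ v) = v ++ (u ++ u)) : u ++ v = v ++ u :=
  comm_of_comm_rep (k := 2) (by omega) (by simpa using h)

namespace DblParse

variable {c : ℤ → A} {bl : Bool → List A} {T : ℤ → Bool} {pos : ℤ → ℤ} {n : ℤ}

theorem false_of_length_eq (D : DblParse c bl T pos n)
    (hlen : (bl true).length = (bl false).length) (hp : Prim (bl true)) (hq : Prim (bl false))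
    (htt : ∃ i, T i = true ∧ T (i + 1) = true) (hff : ∃ i, T i = false ∧ T (i + 1) = false)
    (htf : ∃ i, T i = true ∧ T (i + 1) = false) : False := by
  have len : ∀ b, (bl b).length = (bl true).length := by
    intro b; cases b
    · exact hlen.symm
    · rfl
  have hpos : ∀ i, pos i = pos 0 + i * (bl true).length := by
    intro i
    induction i using Int.induction_on with
    | zero => simp
    | succ i ih => rw [D.step, len, ih]; ring
    | pred i ih =>
      have := D.step (-i - 1)
      rw [len, show (-(i : ℤ) - 1 + 1) = -i by ring, ih] at this
      linarith
  obtain ⟨k, hk, hk'⟩ := D.locate_shift 0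
  rw [D.step, len] at hk'
  obtain ⟨d, hd⟩ : ∃ d : ℕ, (d : ℤ) = pos k + (bl true).length - pos 0 - n :=
    ⟨(pos k + (bl true).length - pos 0 - n).toNat, by omega⟩
  have hd₀ : 0 < d := by omega
  have hd₁ : d < (bl true).length := by omega
  have key : ∀ b b', (∃ i, T i = b ∧ T (i + 1) = b') →
      ∃ b'', bl b'' = (bl b).drop d ++ (bl b').take d := by
    rintro b b' ⟨i, rfl, rfl⟩
    refine ⟨T (k + 1 + i), ?_⟩
    have o := D.occ_shift i
    have o' := D.occ_shift (i + 1)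
    have s := D.step i
    have e : pos (k + 1 + i) = pos i + n + d := by
      rw [hd, hpos (k + 1 + i), hpos i, hpos k]; ring
    rw [← o.slice_drop (by rw [len]; omega), ← o'.slice_take (by rw [len]; omega), s,
      show pos i + n + (bl (T i)).length = pos i + (bl (T i)).length + n by ring,
      slice_append c (by rw [len]; omega) (by omega)]
    refine (D.occ (k + 1 + i)).symm.trans ?_
    rw [e, len (T (k + 1 + i)), len (T i)]
    congr 1; ring
  have nt : (bl true).take d ++ (bl true).drop d ≠ (bl true).drop d ++ (bl true).take d := by
    intro h
    rcases hp.2 _ _ (List.take_append_drop d _).symm h with h | h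
    · have := congrArg List.length h
      simp only [List.length_take, List.length_nil] at this
      omega
    · have := congrArg List.length h
      simp only [List.length_drop, List.length_nil] at this
      omega
  have nf : (bl false).take d ++ (bl false).drop d ≠ (bl false).drop d ++ (bl false).take d := by
    intro h
    rcases hq.2 _ _ (List.take_append_drop d _).symm h with h | h
    · have := congrArg List.length h
      simp only [List.length_take, List.length_nil] at this
      omega
    · have := congrArg List.length h
      simp only [List.length_drop, List.length_nil] at this
      omega
  obtain ⟨b₁, h₁⟩ := key _ _ htt
  obtain ⟨b₂, h₂⟩ := key _ _ hff
  obtain ⟨b₃, h₃⟩ := key _ _ htf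
  have et := List.take_append_drop d (bl true)
  have ef := List.take_append_drop d (bl false)
  have lt : ((bl true).take d).length = d := by simp; omega
  have lf : ((bl false).take d).length = d := by simp; omega
  generalize (bl true).take d = L₁ at *
  generalize (bl true).drop d = L₂ at *
  generalize (bl false).take d = S₁ at *
  generalize (bl false).drop d = S₂ at *
  cases b₁
  swap
  · exact nt (et.trans h₁)
  cases b₂
  · exact nf (ef.trans h₂)
  cases b₃
  · have e : S₁ = L₁ := List.append_cancel_left (h₃.symm.trans h₁)
    subst e
    refine nt (comm_of_sq_comm ?_)
    rw [et.trans h₂, ← List.append_assoc, ef.trans h₁, List.append_assoc]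
  · have e : L₂ = S₂ := List.append_cancel_right (h₃.symm.trans h₂)
    subst e
    refine nf (comm_of_sq_comm ?_).symm
    rw [← h₃, ← et, ← List.append_assoc, ← h₁, ← ef, List.append_assoc]

end DblParse

theorem Parse.pos_run {c : ℤ → A} {bl : Bool → List A} {T : ℤ → Bool} {pos : ℤ → ℤ}
    (P : Parse c bl T pos) {b : Bool} {k : ℤ} {j : ℕ}
    (h : ∀ m, k ≤ m → m < k + j → T m = b) : pos (k + j) = pos k + j * (bl b).length := by
  induction j with
  | zero => simp
  | succ j ih =>
    have := ih fun m h₁ h₂ => h m h₁ (by push_cast; omega)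
    push_cast
    rw [← add_assoc, P.step, this, h (k + j) (by omega) (by push_cast; omega)]
    ring

/-- A long run of a short primitive block is impossible. -/
theorem DblParse.false_of_long_run {c : ℤ → A} {bl : Bool → List A} {T : ℤ → Bool} {pos : ℤ → ℤ}
    {n : ℤ} (D : DblParse c bl T pos n) (hp : Prim (bl true)) {t : ℕ} (ht : 2 ≤ t)
    (hle : (bl false).length ≤ t * (bl true).length)
    (no_cube : ∀ i, T i = false → T (i + 1) = false → T (i + 2) = true) {i : ℤ}
    (hrun : ∀ m, i ≤ m → m < i + (3 * t : ℕ) → T m = true) : False := by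
  have e := D.pos_run hrun
  have inner : ∀ k, pos i + n < pos k → pos k + (bl true).length ≤ pos (i + (3 * t : ℕ)) + n →
      T k = false := by
    intro k h₁ h₂
    by_contra hk
    rw [Bool.not_eq_false] at hk
    obtain ⟨m, hm, hm'⟩ := D.locate (pos k - n)
    have m₁ : i ≤ m := by
      have : i < m + 1 := D.strictMono.lt_iff_lt.1 (by omega)
      omega
    have d₁ := D.disj m k
    have d₂ := D.disj (m + 1) k
    have s := D.step m
    have o := D.occ_shift m
    have o' := D.occ_shift (m + 1)
    have ok := D.occ k
    have m₂ : m < i + (3 * t : ℕ) := D.strictMono.lt_iff_lt.1 (by omega)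
    rw [hrun m m₁ m₂] at s o
    have m₃ : m + 1 < i + (3 * t : ℕ) := D.strictMono.lt_iff_lt.1 (by omega)
    rw [hrun (m + 1) (by omega) m₃] at o'
    rw [hk] at ok
    have := hp.align o (o'.of_eq (by omega)) ok (by omega) (by omega)
    omega
  have hτ : 2 * (bl true).length ≤ t * (bl true).length := Nat.mul_le_mul_right _ ht
  have e' : pos (i + (3 * t : ℕ)) = pos i + 3 * (t * (bl true).length : ℕ) := by
    rw [e]; push_cast; ring
  rw [e'] at inner
  generalize t * (bl true).length = τ at *
  have hρ := List.length_pos_iff.2 (D.ne true)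
  obtain ⟨k, hk, hk'⟩ := D.locate_shift i
  have len : ∀ j, (bl (T j)).length ≤ τ := by
    intro j; cases T j <;> omega
  have l₀ := len k
  have s₀ := D.step k
  have s₁ := D.step (k + 1)
  have s₂ := D.step (k + 2)
  rw [show k + 1 + 1 = k + 2 by ring] at s₁
  rw [show k + 2 + 1 = k + 3 by ring] at s₂
  have b₁ := inner (k + 1) hk' (by omega)
  rw [b₁] at s₁
  have b₂ := inner (k + 2) (by omega) (by omega)
  rw [b₂] at s₂
  have b₀ : T k = true := by
    by_contra h
    rw [Bool.not_eq_true] at h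
    exact absurd (no_cube k h b₁) (by simp [b₂])
  rw [b₀] at s₀
  have b₃ := no_cube (k + 1) b₁ (by rw [add_assoc]; exact b₂)
  rw [show k + 1 + 2 = k + 3 by ring] at b₃
  have := inner (k + 3) (by omega) (by omega)
  simp [b₃] at this

theorem comm_of_left_equations {x₁ x₂ p y q r : List A} (hp : p ≠ []) (hlen : x₁.length = p.length)
    (h₁ : p ++ y = y ++ x₁) (h₂ : x₁ ++ x₂ = x₂ ++ p) (h₃ : y = x₂ ++ (q ++ r))
    (hq : q = x₁ ∨ q = p) : (x₁ ++ x₂) ++ y = y ++ (x₁ ++ x₂) := by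
  suffices h : x₁ = p ∧ p ++ x₂ = x₂ ++ p by
    obtain ⟨rfl, h⟩ := h
    exact comm_append h₁ (comm_trans hp h h₁)
  have e : p ++ (x₂ ++ (q ++ r)) = x₂ ++ (q ++ (r ++ x₁)) := by
    rw [← h₃, h₁, h₃]; simp
  rcases le_or_gt p.length x₂.length with hle | hlt
  · obtain ⟨g, rfl⟩ : p <+: x₂ :=
      List.prefix_of_prefix_length_le ⟨_, e⟩ ⟨_, rfl⟩ hle
    have : x₁ = p := by
      rw [List.append_assoc] at h₂
      exact (List.append_inj h₂ hlen).1
    subst this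
    exact ⟨rfl, h₂⟩
  · obtain ⟨g, rfl⟩ : x₂ <+: p :=
      List.prefix_of_prefix_length_le ⟨_, rfl⟩ ⟨_, e⟩ hlt.le
    rw [List.append_assoc, List.append_cancel_left_eq, ← List.append_assoc] at e
    have hql : q.length = (g ++ x₂).length := by
      rcases hq with rfl | rfl <;> simp_all <;> omega
    have hq' : g ++ x₂ = q := (List.append_inj e hql.symm).1
    have hc : x₂ ++ g = g ++ x₂ := by
      rcases hq with rfl | rfl
      · subst hq'
        exact comm_of_sq_comm (by rw [← h₂]; simp)
      · exact hq'.symm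
    refine ⟨?_, comm_append rfl hc.symm⟩
    rw [hc, ← List.append_assoc] at h₂
    rw [hc] at h₂ ⊢
    exact List.append_cancel_right h₂

theorem comm_of_special_equations {u v y r r' : List A} (hne : u ++ v ≠ [])
    (h₁ : y = u ++ (u ++ v) ++ r) (h₂ : y = v ++ (u ++ v) ++ r')
    (h₃ : (u ++ (u ++ v)) ++ y = y ++ ((u ++ v) ++ u)) : (u ++ v) ++ y = y ++ (u ++ v) := by
  have e : u ++ (u ++ (v ++ r)) = v ++ (u ++ (v ++ r')) := by
    rw [h₁] at h₂; simpa using h₂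
  have huv : u ++ v = v ++ u := by
    rcases le_total v.length u.length with hle | hle
    · obtain ⟨g, rfl⟩ : v <+: u := List.prefix_of_prefix_length_le ⟨_, rfl⟩ ⟨_, e⟩ hle
      have e' : (g ++ v) ++ (g ++ (v ++ r)) = (v ++ g) ++ (v ++ r') := by simpa using e
      have := (List.append_inj e' (by simp; omega)).1
      rw [List.append_assoc, this]
    · obtain ⟨g, rfl⟩ : u <+: v := List.prefix_of_prefix_length_le ⟨_, e⟩ ⟨_, rfl⟩ hle
      have e' : (u ++ (u ++ g)) ++ r = (g ++ (u ++ u)) ++ (g ++ r') := by simpa using e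
      have := comm_of_sq_comm (List.append_inj e' (by simp; omega)).1
      rw [List.append_assoc, this]
  have h₄ : (u ++ v) ++ u = u ++ (u ++ v) := by rw [List.append_assoc, ← huv]
  rw [h₄] at h₃
  exact comm_trans (u := u ++ (u ++ v)) (by simp at hne ⊢; tauto)
    (comm_append h₄.symm rfl) h₃

theorem Occ.eq_slice {c : ℤ → A} {u : List A} {q b : ℤ} (h : Occ c u q) (hb : b = q + u.length) :
    u = slice c q b := by
  subst hb; exact h.symm

theorem Occ.append_slice {c : ℤ → A} {u : List A} {q b d : ℤ} (h : Occ c u q)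
    (hb : b = q + u.length) (hd : b ≤ d) : u ++ slice c b d = slice c q d := by
  nth_rewrite 1 [h.eq_slice hb]
  exact slice_append c (by omega) hd

theorem Occ.slice_append_self {c : ℤ → A} {u : List A} {a q b : ℤ} (h : Occ c u q)
    (hb : b = q + u.length) (ha : a ≤ q) : slice c a q ++ u = slice c a b := by
  nth_rewrite 1 [h.eq_slice hb]
  exact slice_append c ha (by omega)

theorem comm_of_left {c : ℤ → A} {x y : List A} {a Z : ℤ} (hx : x.length < y.length)
    (t₁ : Occ c x (a - x.length)) (t₂ : Occ c y a) (t₃ : Occ c y (a + y.length))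
    (b₁ : Occ c x (Z - x.length)) (b₂ : Occ c y Z) (b₃ : Occ c x (Z + y.length))
    (b₄ : Occ c x (Z + y.length + x.length) ∨ Occ c y (Z + y.length + x.length))
    (h₁ : Z < a) (h₂ : a < Z + x.length) : x ++ y = y ++ x := by
  have E₁ : slice c (Z + y.length) (a + y.length) ++
      slice c (a + y.length) (Z + y.length + x.length) = x := by
    rw [slice_append c (by omega) (by omega)]; exact b₃
  have f : slice c (a - x.length) Z = slice c (a + y.length) (Z + y.length + x.length) :=
    b₁.slice_eq b₃ (by omega) (by omega) (by omega) (by omega)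
  rw [← E₁]
  refine comm_of_left_equations (p := slice c Z a)
    (q := slice c (Z + y.length + x.length) (a + y.length + x.length))
    (r := slice c (a + y.length + x.length) (a + y.length + y.length))
    (slice_ne_nil c h₁) (by rw [length_slice, length_slice]; congr 1; ring) ?_ ?_ ?_ ?_
  · rw [t₂.slice_append_self rfl h₁.le, b₂.append_slice rfl (by omega)]
  · rw [E₁, ← f, slice_append c (by omega) (by omega)]
    refine t₁.symm.trans ?_
    congr 1; ring
  · rw [slice_append c (by omega) (by omega), slice_append c (by omega) (by omega)]
    exact t₃.symm
  · rcases b₄ with b₄ | b₄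
    · exact Or.inl (b₄.slice_eq b₃ (by omega) (by omega) (by omega) (by omega))
    · exact Or.inr (b₄.slice_eq b₂ (by omega) (by omega) (by omega) (by omega))

theorem Occ.reverse {c : ℤ → A} {u : List A} {q : ℤ} (h : Occ c u q) :
    Occ (fun t => c (-1 - t)) u.reverse (-q - u.length) := by
  unfold Occ
  have h' : slice (fun t => c (-1 - t)) (-q - u.length) (-q) =
      (slice c q (q + u.length)).reverse := by
    have e : ∀ (m : ℕ) (d : ℤ), slice (fun t => c (-1 - t)) (-d - m) (-d) =
        (slice c d (d + m)).reverse := by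
      intro m
      induction m with
      | zero => intro d; simp [slice]
      | succ m ih =>
        intro d
        rw [← slice_append _ (b := -(d + 1)) (by omega) (by omega),
          ← slice_append c (b := d + 1) (by omega) (by push_cast; omega), List.reverse_append]
        have := ih (d + 1)
        rw [show -(d + 1) - (m : ℤ) = -d - (m + 1 : ℕ) by push_cast; ring,
          show d + 1 + (m : ℤ) = d + (m + 1 : ℕ) by push_cast; ring] at this
        rw [this]
        congr 1
        simp only [slice]
        rw [show (-d - -(d + 1)).toNat = 1 by omega, show (d + 1 - d).toNat = 1 by omega]
        simp only [List.range_one, List.map_cons, List.map_nil, List.reverse_cons, List.reverse_nil,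
          List.nil_append]
        congr 2; simp
    exact e _ _
  rw [h] at h'
  rw [List.length_reverse, ← h']
  congr 1; ring

theorem comm_of_right {c : ℤ → A} {x y : List A} {a V : ℤ} (hx : x.length < y.length)
    (t₁ : Occ c y a) (t₂ : Occ c y (a + y.length)) (t₃ : Occ c x (a + 2 * y.length))
    (b₁ : Occ c x (V + y.length)) (b₂ : Occ c y V) (b₃ : Occ c x (V - x.length))
    (b₄ : Occ c x (V - 2 * x.length) ∨ Occ c y (V - x.length - y.length))
    (h₁ : a + y.length < V) (h₂ : V < a + y.length + x.length) : x ++ y = y ++ x := by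
  have := comm_of_left (c := fun t => c (-1 - t)) (x := x.reverse) (y := y.reverse)
    (a := -a - 2 * y.length) (Z := -V - y.length) (by simpa using hx)
    (t₃.reverse.of_eq (by simp; ring)) (t₂.reverse.of_eq (by ring))
    (t₁.reverse.of_eq (by simp; ring)) (b₁.reverse.of_eq (by simp; ring))
    (b₂.reverse.of_eq (by ring)) (b₃.reverse.of_eq (by simp))
    (b₄.imp (fun h => h.reverse.of_eq (by simp; ring)) fun h => h.reverse.of_eq (by simp; ring))
    (by omega) (by simp; omega)
  rw [← List.reverse_append, ← List.reverse_append, List.reverse_inj] at this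
  exact this.symm

theorem comm_of_special {c : ℤ → A} {x y : List A} {a Z : ℤ}
    (t₀ : Occ c y (a - x.length - y.length)) (t₁ : Occ c x (a - x.length)) (t₂ : Occ c y a)
    (t₃ : Occ c y (a + y.length))
    (b₁ : Occ c x (Z - x.length)) (b₂ : Occ c y Z) (b₃ : Occ c x (Z + y.length))
    (b₄ : Occ c x (Z + y.length + x.length)) (b₅ : Occ c x (Z + y.length + 2 * x.length))
    (h₁ : Z + x.length < a) (h₂ : a < Z + 2 * x.length) (h₃ : a < Z + y.length)
    (h₄ : Z + 3 * x.length < a + y.length) : x ++ y = y ++ x := by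
  have E : slice c (Z + y.length + x.length) (a + y.length) ++
      slice c (a + y.length) (Z + y.length + 2 * x.length) = x := by
    rw [slice_append c (by omega) (by omega)]
    refine Eq.trans ?_ b₄
    congr 1; ring
  have hp : slice c Z (a - x.length) = slice c (Z + y.length + x.length) (a + y.length) :=
    t₀.slice_eq t₂ (by omega) (by omega) (by omega) (by omega)
  have hx₁ : slice c (Z + y.length + x.length) (a + y.length) ++ x = slice c Z a := by
    rw [← hp, t₁.slice_append_self (by ring) (by omega)]
  have hx₂ : x ++ slice c (Z + y.length + x.length) (a + y.length) =
      slice c (Z + y.length) (a + y.length) := by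
    exact b₃.append_slice rfl (by omega)
  have key := comm_of_special_equations (y := y)
    (u := slice c (Z + y.length + x.length) (a + y.length))
    (v := slice c (a + y.length) (Z + y.length + 2 * x.length))
    (r := slice c a (Z + y.length))
    (r' := slice c (Z + y.length + 3 * x.length) (a + 2 * y.length))
  rw [E, hx₁, hx₂] at key
  refine key ?_ ?_ ?_ ?_
  · rintro rfl; simp at *; omega
  · rw [slice_append c (by omega) (by omega)]; exact b₂.symm
  · rw [b₅.slice_append_self (b := Z + y.length + 3 * x.length) (by ring) (by omega),
      slice_append c (by omega) (by omega)]
    exact t₃.eq_slice (by ring)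
  · rw [t₂.slice_append_self rfl (by omega), b₂.append_slice rfl (by omega)]

/-- The case in which the long block is primitive and the pattern `y x y y x y` occurs. -/
theorem DblParse.false_of_pattern {c : ℤ → A} {bl : Bool → List A} {T : ℤ → Bool} {pos : ℤ → ℤ}
    {n : ℤ} (D : DblParse c bl T pos n) (hp : Prim (bl false))
    (hne : bl true ++ bl false ≠ bl false ++ bl true)
    (hlt : (bl true).length < (bl false).length)
    (h₀ : ∀ k, T k = true → T (k + 1) = true → T (k + 2) = true → T (k + 3) = false)
    (h₁ : ∀ k, T k = false → T (k + 1) = false → T (k + 2) = true → T (k + 3) = false)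
    (h₂ : ∀ k, T k = true → T (k + 1) = true → T (k + 2) = false → T (k + 3) = true)
    (h₃ : ∀ k, T k = false → T (k + 1) = false → T (k + 2) = true → T (k + 3) = false →
      T (k + 4) = true) {i : ℤ}
    (i₀ : T i = false) (i₁ : T (i + 1) = true) (i₂ : T (i + 2) = false) (i₃ : T (i + 3) = false)
    (i₄ : T (i + 4) = true) : False := by
  have hX : 0 < (bl true).length := List.length_pos_iff.2 (D.ne _)
  have p₀ := D.step i
  have p₁ := D.step (i + 1)
  have p₂ := D.step (i + 2)
  have p₃ := D.step (i + 3)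
  have p₄ := D.step (i + 4)
  rw [i₀] at p₀
  rw [i₁, show i + 1 + 1 = i + 2 by ring] at p₁
  rw [i₂, show i + 2 + 1 = i + 3 by ring] at p₂
  rw [i₃, show i + 3 + 1 = i + 4 by ring] at p₃
  rw [i₄, show i + 4 + 1 = i + 5 by ring] at p₄
  have o₀ := D.occ_shift i
  have o₁ := D.occ_shift (i + 1)
  have o₂ := D.occ_shift (i + 2)
  have o₃ := D.occ_shift (i + 3)
  have o₄ := D.occ_shift (i + 4)
  rw [i₀] at o₀
  rw [i₁] at o₁
  rw [i₂] at o₂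
  rw [i₃] at o₃
  rw [i₄] at o₄
  have len : ∀ k, ((bl (T k)).length : ℤ) ≤ (bl false).length := by
    intro k; cases T k <;> omega
  have hR : ∀ t, pos (i + 2) + n ≤ t → t + (bl false).length < pos (i + 4) + n →
      c t = c (t + (bl false).length) := by
    intro t
    refine D.run_shift fun m hm₁ hm₂ => ?_
    obtain rfl | rfl : m = i + 2 ∨ m = i + 3 := by omega
    all_goals assumption
  obtain ⟨k₀, hk₀, hk₀'⟩ := D.locate_shift (i + 2)
  obtain ⟨k₁, hk₁, hk₁'⟩ := D.locate_shift (i + 4)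
  have inner : ∀ k, k₀ < k → k < k₁ → T k = true := by
    intro k hk hk'
    by_contra hb
    rw [Bool.not_eq_true] at hb
    have o := D.occ k
    have s := D.step k
    rw [hb] at o s
    have m₁ : pos (k₀ + 1) ≤ pos k := D.strictMono.monotone (by omega)
    have m₂ : pos (k + 1) ≤ pos k₁ := D.strictMono.monotone (by omega)
    have d₀ := D.disj (i + 2) k
    have d₁ := D.disj (i + 3) k
    have := hp.align o₂ (o₃.of_eq (by omega)) o (by omega) (by omega)
    omega
  have l₀ := len k₀
  have s₀ := D.step k₀
  have hkk : k₀ + 1 < k₁ := D.strictMono.lt_iff_lt.1 (by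
    have := len k₁; have := D.step k₁; omega)
  have j₁ := inner (k₀ + 1) (by omega) (by omega)
  have j₁' := inner (k₁ - 1) (by omega) (by omega)
  have s₁ := D.step (k₀ + 1)
  have s₁' := D.step (k₁ - 1)
  rw [j₁, show k₀ + 1 + 1 = k₀ + 2 by ring] at s₁
  rw [j₁', show k₁ - 1 + 1 = k₁ by ring] at s₁'
  have q₁ := D.occ (k₀ + 1)
  have q₁' := D.occ (k₁ - 1)
  rw [j₁] at q₁
  rw [j₁'] at q₁'
  have left : T k₀ = false → T (k₀ - 1) = true →
      pos (i + 2) + n < pos k₀ + (bl true).length → False := by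
    intro e₀ e₁ h
    have s := D.step (k₀ - 1)
    have o := D.occ (k₀ - 1)
    have q₀ := D.occ k₀
    have q₂ := D.occ (k₀ + 2)
    rw [e₁, show k₀ - 1 + 1 = k₀ by ring] at s
    rw [e₁] at o
    rw [e₀] at q₀ s₀
    refine hne (comm_of_left (c := c) (a := pos (i + 2) + n) (Z := pos k₀) hlt
      (o₁.of_eq (by omega)) o₂ (o₃.of_eq (by omega)) (o.of_eq (by omega)) q₀
      (q₁.of_eq (by omega)) ?_ hk₀ h)
    cases h : T (k₀ + 2) <;> rw [h] at q₂
    · exact Or.inr (q₂.of_eq (by omega))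
    · exact Or.inl (q₂.of_eq (by omega))
  have right : T k₁ = false → T (k₁ + 1) = true →
      pos k₁ < pos (i + 3) + n + (bl true).length → False := by
    intro e₀ e₁ h
    have s := D.step k₁
    have o := D.occ (k₁ + 1)
    have q₀ := D.occ k₁
    have q₂ := D.occ (k₁ - 2)
    have s₂ := D.step (k₁ - 2)
    rw [show k₁ - 2 + 1 = k₁ - 1 by ring] at s₂
    rw [e₁] at o
    rw [e₀] at q₀ s
    refine hne (comm_of_right (c := c) (a := pos (i + 2) + n) (V := pos k₁) hlt
      o₂ (o₃.of_eq (by omega)) (o₄.of_eq (by omega)) (o.of_eq (by omega)) q₀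
      (q₁'.of_eq (by omega)) ?_ (by omega) (by omega))
    cases h : T (k₁ - 2) <;> rw [h] at q₂ s₂
    · exact Or.inr (q₂.of_eq (by omega))
    · exact Or.inl (q₂.of_eq (by omega))
  have before : T k₀ = false → T (k₀ + 2) = true → T (k₀ - 1) = true := by
    intro e₀ e₂
    by_contra h
    rw [Bool.not_eq_true] at h
    have := h₁ (k₀ - 1) h (by simpa using e₀) (by rw [show k₀ - 1 + 2 = k₀ + 1 by ring]; exact j₁)
    rw [show k₀ - 1 + 3 = k₀ + 2 by ring, e₂] at this
    cases this
  have after : T k₁ = false → T (k₁ - 2) = true → T (k₁ + 1) = true := by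
    intro e₀ e₂
    have := h₂ (k₁ - 2) e₂ (by rw [show k₁ - 2 + 1 = k₁ - 1 by ring]; exact j₁')
      (by simpa using e₀)
    rwa [show k₁ - 2 + 3 = k₁ + 1 by ring] at this
  have in₂ : T k₁ = true → T (k₀ + 2) = true := by
    intro e
    rcases (show k₀ + 2 ≤ k₁ by omega).eq_or_lt with h | h
    · rwa [h]
    · exact inner _ (by omega) h
  have in₂' : T k₀ = true → T (k₁ - 2) = true := by
    intro e
    rcases (show k₀ ≤ k₁ - 2 by omega).eq_or_lt with h | h
    · rwa [← h]
    · exact inner _ (by omega) (by omega)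
  cases e₀ : T k₀ <;> cases e₁ : T k₁
  · rw [e₀] at s₀
    have q₀ := D.occ k₀
    rw [e₀] at q₀
    have t₁ := D.step k₁
    rw [e₁] at t₁
    have hK : k₁ = k₀ + 2 ∨ k₁ = k₀ + 3 ∨ k₁ = k₀ + 4 := by
      by_contra h
      have := h₀ (k₀ + 1) j₁ (inner _ (by omega) (by omega)) (inner _ (by omega) (by omega))
      rw [inner _ (by omega) (by omega)] at this
      cases this
    rcases hK with rfl | rfl | rfl
    · cases e : T (k₀ - 1)
      · have := h₃ (k₀ - 1) e (by simpa using e₀)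
          (by rw [show k₀ - 1 + 2 = k₀ + 1 by ring]; exact j₁)
          (by rw [show k₀ - 1 + 3 = k₀ + 2 by ring]; exact e₁)
        rw [show k₀ - 1 + 4 = k₀ + 2 + 1 by ring] at this
        exact right e₁ this (by omega)
      · exact left e₀ e (by omega)
    · have s₂ := s₁'
      rw [show k₀ + 3 - 1 = k₀ + 2 by ring] at s₂
      have d := D.disj (i + 5) (k₀ + 3 + 1)
      by_cases hP : pos (i + 2) + n < pos k₀ + (bl true).length
      · exact left e₀ (before e₀ (inner _ (by omega) (by omega))) hP
      · exact right e₁ (after e₁ (inner _ (by omega) (by omega))) (by omega)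
    · have j₂ := inner (k₀ + 2) (by omega) (by omega)
      have s₂ := D.step (k₀ + 2)
      rw [j₂, show k₀ + 2 + 1 = k₀ + 3 by ring] at s₂
      have s₃ := s₁'
      rw [show k₀ + 4 - 1 = k₀ + 3 by ring] at s₃
      have d := D.disj (i + 5) (k₀ + 4 + 1)
      have d' := D.disj (i + 1) k₀
      have hb := before e₀ j₂
      by_cases hP : pos (i + 2) + n < pos k₀ + (bl true).length
      · exact left e₀ hb hP
      by_cases hQ : pos (k₀ + 4) < pos (i + 3) + n + (bl true).length
      · exact right e₁ (after e₁ (inner _ (by omega) (by omega))) hQ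
      have s := D.step (k₀ - 1)
      have o := D.occ (k₀ - 1)
      rw [hb, show k₀ - 1 + 1 = k₀ by ring] at s
      rw [hb] at o
      have q₂ := D.occ (k₀ + 2)
      rw [j₂] at q₂
      have q₃ := D.occ (k₀ + 3)
      rw [inner (k₀ + 3) (by omega) (by omega)] at q₃
      exact hne (comm_of_special (c := c) (a := pos (i + 2) + n) (Z := pos k₀)
        (o₀.of_eq (by omega)) (o₁.of_eq (by omega)) o₂ (o₃.of_eq (by omega)) (o.of_eq (by omega))
        q₀ (q₁.of_eq (by omega)) (q₂.of_eq (by omega)) (q₃.of_eq (by omega)) (by omega) (by omega)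
        (by omega) (by omega))
  · rw [e₀] at s₀
    by_cases hP : pos (i + 2) + n < pos k₀ + (bl true).length
    · exact left e₀ (before e₀ (in₂ e₁)) hP
    · refine hp.no_shorter_period (q := pos (k₀ + 1)) o₂ hR (fun t ht₁ ht₂ => ?_) (by omega)
        (by omega) (s := (bl true).length) (by omega) (by omega) (by omega)
      refine D.run (k := k₀ + 1) (k' := k₁ + 1) (fun m hm₁ hm₂ => ?_) (by omega) (by omega)
      rcases (Int.lt_add_one_iff.1 hm₂).eq_or_lt with rfl | h
      · exact e₁
      · exact inner m (by omega) h
  · by_cases hQ : pos k₁ < pos (i + 3) + n + (bl true).length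
    · exact right e₁ (after e₁ (in₂' e₀)) hQ
    · refine hp.no_shorter_period (q := pos (i + 2) + n) o₂ hR (fun t ht₁ ht₂ => ?_) (by omega)
        (by omega) (s := (bl true).length) (by omega) (by omega) (by omega)
      refine D.run (k := k₀) (k' := k₁) (fun m hm₁ hm₂ => ?_) (by omega) (by omega)
      rcases hm₁.eq_or_lt with rfl | h
      · exact e₀
      · exact inner m h hm₂
  · refine hp.no_shorter_period (q := pos (i + 2) + n) o₂ hR (fun t ht₁ ht₂ => ?_) (by omega)
      (by omega) (s := (bl true).length) (by omega) (by omega) (by omega)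
    refine D.run (k := k₀) (k' := k₁ + 1) (fun m hm₁ hm₂ => ?_) (by omega) (by omega)
    rcases hm₁.eq_or_lt with rfl | h
    · exact e₀
    · rcases (Int.lt_add_one_iff.1 hm₂).eq_or_lt with rfl | h'
      · exact e₁
      · exact inner m h h'

/-- The two-sided infinite word with period `u`. -/
def per [Inhabited A] (u : List A) (q : ℤ) : A := u.getD (q % u.length).toNat default

theorem per_eq [Inhabited A] {u : List A} (q : ℤ) {r : ℕ} (hr : r < u.length) :
    per u (u.length * q + r) = u[r] := by
  have : ((u.length * q + r : ℤ) % u.length).toNat = r := by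
    rw [Int.mul_add_emod_self_left, Int.emod_eq_of_lt (by omega) (by omega)]; simp
  rw [per, this, List.getD_eq_getElem _ _ hr]

theorem per_add_mul [Inhabited A] (u : List A) (q e : ℤ) : per u (q + u.length * e) = per u q := by
  rw [per, per, Int.add_mul_emod_self_left]

theorem exists_mul_add {N : ℕ} (hN : 0 < N) (i : ℤ) : ∃ (q : ℤ) (r : ℕ), r < N ∧ i = N * q + r :=
  ⟨i / N, (i % N).toNat, by have := Int.emod_lt_of_pos i (b := N) (by omega); omega, by
    rw [Int.toNat_of_nonneg (Int.emod_nonneg _ (by omega)), Int.mul_ediv_add_emod]⟩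

theorem getElem_rep (k : ℕ) (u : List A) (i : ℕ) (h : i < (rep k u).length) :
    (rep k u)[i] = u[i % u.length]'(Nat.mod_lt _ (by
      rcases Nat.eq_zero_or_pos u.length with h₀ | h₀
      · simp [h₀] at h
      · exact h₀)) := by
  induction k generalizing i with
  | zero => simp at h
  | succ k ih =>
    simp only [rep_succ]
    rw [List.getElem_append]
    split
    · next hi => simp only [Nat.mod_eq_of_lt hi]
    · next hi =>
      rw [ih]
      simp only [Nat.mod_eq_sub_mod (not_lt.1 hi)]

theorem per_rep [Inhabited A] {k : ℕ} (hk : 1 ≤ k) (u : List A) : per (rep k u) = per u := by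
  rcases Nat.eq_zero_or_pos u.length with h₀ | h₀
  · rw [List.length_eq_zero_iff.1 h₀]
    congr 1
    exact List.length_eq_zero_iff.1 (by simp)
  ext i
  obtain ⟨q, r, hr, rfl⟩ := exists_mul_add (N := (rep k u).length)
    (by rw [length_rep]; exact Nat.mul_pos hk h₀) i
  rw [per_eq q hr, getElem_rep]
  have : (((rep k u).length : ℤ) * q + r) = u.length * (k * q + r / u.length) +
      (r % u.length : ℕ) := by
    rw [length_rep]; push_cast
    have := Int.mul_ediv_add_emod r u.length
    linear_combination -this
  rw [this, per_eq _ (Nat.mod_lt _ h₀)]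

theorem occ_per [Inhabited A] {u a b e : List A} (h : u = a ++ b ++ e) (q : ℤ) :
    Occ (per u) b (u.length * q + a.length) := by
  apply List.ext_getElem
  · rw [length_slice]; omega
  · intro i h₁ h₂
    have hlen : a.length + i < u.length := by rw [h]; simp; omega
    simp only [slice, List.getElem_map, List.getElem_range]
    rw [show (u.length * q + a.length + i : ℤ) = u.length * q + (a.length + i : ℕ) by
      push_cast; ring, per_eq q hlen]
    subst h
    rw [List.getElem_append_left (by simp; omega), List.getElem_append_right (by omega)]
    simp

/-- The starting position of the `i`-th block in the periodic text `per (w.flatMap bl)`. -/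
def blockPos (bl : Bool → List A) (w : List Bool) (i : ℤ) : ℤ :=
  (w.flatMap bl).length * (i / w.length) + ((w.take (i % w.length).toNat).flatMap bl).length

theorem blockPos_eq (bl : Bool → List A) {w : List Bool} (q : ℤ) {r : ℕ} (hr : r < w.length) :
    blockPos bl w (w.length * q + r) =
      (w.flatMap bl).length * q + ((w.take r).flatMap bl).length := by
  have h₁ : (w.length * q + r : ℤ) % w.length = r := by
    rw [Int.mul_add_emod_self_left, Int.emod_eq_of_lt (by omega) (by omega)]
  have h₂ : (w.length * q + r : ℤ) / w.length = q := by
    rw [Int.mul_add_ediv_left _ _ (by omega), Int.ediv_eq_zero_of_lt (by omega) (by omega)]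
    simp
  rw [blockPos, h₁, h₂]; simp

theorem blockPos_add_mul (bl : Bool → List A) {w : List Bool} (hw : w ≠ []) (i e : ℤ) :
    blockPos bl w (i + w.length * e) = blockPos bl w i + (w.flatMap bl).length * e := by
  obtain ⟨q, r, hr, rfl⟩ := exists_mul_add (List.length_pos_iff.2 hw) i
  rw [show (w.length * q + r + w.length * e : ℤ) = w.length * (q + e) + r by ring,
    blockPos_eq bl _ hr, blockPos_eq bl _ hr]
  ring

theorem parse_per [Inhabited A] {bl : Bool → List A} (hbl : ∀ b, bl b ≠ []) {w : List Bool}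
    (hw : w ≠ []) : Parse (per (w.flatMap bl)) bl (per w) (blockPos bl w) where
  ne := hbl
  step i := by
    obtain ⟨q, r, hr, rfl⟩ := exists_mul_add (List.length_pos_iff.2 hw) i
    have e : ((w.take (r + 1)).flatMap bl).length =
        ((w.take r).flatMap bl).length + (bl w[r]).length := by
      rw [List.take_succ_eq_append_getElem hr, List.flatMap_append]; simp
    rw [per_eq q hr, blockPos_eq bl q hr]
    rcases (Nat.succ_le_of_lt hr).eq_or_lt with h | h
    · rw [show (w.length * q + r + 1 : ℤ) = w.length * (q + 1) + (0 : ℕ) by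
        rw [← h]; push_cast; ring, blockPos_eq bl _ (by omega)]
      have : w.take (r + 1) = w := List.take_of_length_le h.ge
      rw [this] at e
      simp [e]; ring
    · rw [add_assoc, show (r + 1 : ℤ) = (r + 1 : ℕ) by simp, blockPos_eq bl _ h, e]
      push_cast; ring
  occ i := by
    obtain ⟨q, r, hr, rfl⟩ := exists_mul_add (List.length_pos_iff.2 hw) i
    rw [per_eq q hr, blockPos_eq bl q hr]
    refine occ_per (e := (w.drop (r + 1)).flatMap bl) ?_ q
    have : bl w[r] = [w[r]].flatMap bl := by simp
    rw [this, ← List.flatMap_append, ← List.flatMap_append, ← List.take_succ_eq_append_getElem hr,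
      List.take_append_drop]

theorem Parse.slice_eq_flatMap {c : ℤ → A} {bl : Bool → List A} {T : ℤ → Bool} {pos : ℤ → ℤ}
    (P : Parse c bl T pos) (i : ℤ) (k : ℕ) :
    slice c (pos i) (pos (i + k)) = (slice T i (i + k)).flatMap bl := by
  induction k with
  | zero => simp [slice]
  | succ k ih =>
    rw [← slice_append c (P.strictMono.monotone (show i ≤ i + k by omega))
      (P.strictMono.monotone (by push_cast; omega)), ih,
      ← slice_append T (show i ≤ i + k by omega)
        (show i + k ≤ i + (k + 1 : ℕ) by push_cast; omega), List.flatMap_append]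
    congr 1
    rw [show i + ((k + 1 : ℕ) : ℤ) = i + k + 1 by push_cast; ring, P.step, P.occ]
    simp [slice]

theorem exists_dblParse {x y z : List A} {w : List Bool} {m : ℕ} (hm : 2 ≤ m) (hw : w ≠ [])
    (h : w.flatMap (blk x y) = rep m z) (hne : x ++ y ≠ y ++ x)
    (hprim : ∀ d, (∀ i, per w (i + d) = per w i) → (w.length : ℤ) ∣ d) :
    ∃ c pos n, DblParse c (blk x y) (per w) pos n := by
  have hbl : ∀ b, blk x y b ≠ [] := by
    rintro b hb
    apply hne
    cases b <;> simp_all [blk]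
  have : Inhabited A := ⟨x.head (hbl true)⟩
  have P := parse_per hbl hw
  have L : (w.flatMap (blk x y)).length = m * z.length := by rw [h, length_rep]
  have Lpos : 0 < m * z.length := by
    rw [← L]
    obtain ⟨b, w, rfl⟩ := List.exists_cons_of_ne_nil hw
    have := List.length_pos_iff.2 (hbl b)
    simp only [List.flatMap_cons, List.length_append]; omega
  have hz : 0 < z.length := Nat.pos_of_mul_pos_left Lpos
  have hper : ∀ q, per (w.flatMap (blk x y)) (q + z.length) = per (w.flatMap (blk x y)) q := by
    intro q
    rw [h, per_rep (by omega)]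
    simpa using per_add_mul z q 1
  refine ⟨_, _, z.length, P, hper, fun i k hk => hne ?_⟩
  have e₁ := blockPos_add_mul (blk x y) hw i 1
  have e₂ := blockPos_add_mul (blk x y) hw k 1
  rw [mul_one, mul_one] at e₁ e₂
  have s : (slice (per w) i (i + w.length)).flatMap (blk x y) =
      (slice (per w) k (k + w.length)).flatMap (blk x y) := by
    rw [← P.slice_eq_flatMap, ← P.slice_eq_flatMap, slice_eq_iff _ _ (by omega)]
    intro t _ _
    rw [hk, ← hper]
    congr 1; ring
  by_contra hne'
  have s' := not_imp_comm.1 (fun hn => comm_of_relation _ _ hn s) hne'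
  rw [slice_eq_iff _ _ (by ring)] at s'
  obtain ⟨e, he⟩ := hprim (k - i) fun j => by
    obtain ⟨q, r, hr, hj⟩ := exists_mul_add (List.length_pos_iff.2 hw) (j - i)
    have := s' r (by omega) (by omega)
    rw [show j + (k - i) = k + r + w.length * q by linarith,
      show j = i + r + w.length * q by linarith, per_add_mul, per_add_mul, this]
  have e₃ := blockPos_add_mul (blk x y) hw i e
  rw [← he, add_sub_cancel, hk, L] at e₃
  have e₄ : (z.length : ℤ) = z.length * (m * e) := by push_cast at e₃; linarith
  have e₅ : (m : ℤ) * e = 1 := by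
    have := mul_left_cancel₀ (a := (z.length : ℤ)) (by omega) ((mul_one _).trans e₄)
    exact this.symm
  have := Int.eq_one_or_neg_one_of_mul_eq_one e₅
  omega

/-- The letter word `(yx)^a (xxy)^j (xy)^b`, with `x` and `y` encoded by `true` and `false`. -/
def pattern (a j b : ℕ) : List Bool :=
  rep a [false, true] ++ rep j [true, true, false] ++ rep b [true, false]

theorem length_pattern (a j b : ℕ) : (pattern a j b).length = 2 * a + 3 * j + 2 * b := by
  simp [pattern]; ring

theorem getElem_pattern (a j b r : ℕ) (h : r < (pattern a j b).length) :
    (pattern a j b)[r] = false ↔ r < 2 * a ∧ r % 2 = 0 ∨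
      2 * a ≤ r ∧ r < 2 * a + 3 * j ∧ (r - 2 * a) % 3 = 2 ∨
      2 * a + 3 * j ≤ r ∧ (r - 2 * a - 3 * j) % 2 = 1 := by
  have h' := h
  rw [length_pattern] at h'
  simp only [pattern, List.getElem_append, length_rep, List.length_append, List.length_cons,
    List.length_nil, getElem_rep]
  split_ifs with h₁ h₂
  · have : r % (0 + 1 + 1) = 0 ∨ r % (0 + 1 + 1) = 1 := by omega
    rcases this with e | e <;> simp [e] <;> omega
  · have : (r - a * (0 + 1 + 1)) % (0 + 1 + 1 + 1) = 0 ∨ (r - a * (0 + 1 + 1)) % (0 + 1 + 1 + 1) = 1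
      ∨ (r - a * (0 + 1 + 1)) % (0 + 1 + 1 + 1) = 2 := by omega
    rcases this with e | e | e <;> simp [e] <;> omega
  · have : (r - (a * (0 + 1 + 1) + j * (0 + 1 + 1 + 1))) % (0 + 1 + 1) = 0 ∨
      (r - (a * (0 + 1 + 1) + j * (0 + 1 + 1 + 1))) % (0 + 1 + 1) = 1 := by omega
    rcases this with e | e <;> simp [e] <;> omega

theorem per_pattern (a j b : ℕ) (e : ℤ) {r : ℕ} (hr : r < 2 * a + 3 * j + 2 * b) :
    per (pattern a j b) (r + (2 * a + 3 * j + 2 * b : ℕ) * e) = false ↔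
      r < 2 * a ∧ r % 2 = 0 ∨ 2 * a ≤ r ∧ r < 2 * a + 3 * j ∧ (r - 2 * a) % 3 = 2 ∨
      2 * a + 3 * j ≤ r ∧ (r - 2 * a - 3 * j) % 2 = 1 := by
  rw [← length_pattern] at hr ⊢
  rw [add_comm, per_eq e hr, getElem_pattern]

theorem dvd_of_per_pattern {a j b : ℕ} (hb : 2 ≤ b) {k : ℤ}
    (h₀ : per (pattern a j b) k = false) (h₁ : per (pattern a j b) (k + 1) = false) :
    ((2 * a + 3 * j + 2 * b : ℕ) : ℤ) ∣ k + 1 := by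
  obtain ⟨q, r, hr, rfl⟩ := exists_mul_add (N := 2 * a + 3 * j + 2 * b) (by omega) k
  rcases (Nat.succ_le_of_lt hr).eq_or_lt with h | h
  · exact ⟨q + 1, by rw [mul_add, mul_one, add_assoc, ← h]; simp⟩
  · exfalso
    rw [add_comm, per_pattern a j b q hr] at h₀
    rw [add_assoc, add_comm, ← Nat.cast_succ, per_pattern a j b q h] at h₁
    omega

theorem exists_pattern_false {a j b r : ℕ} (hj : 1 ≤ j) (hr : r < 2 * a + 3 * j + 2 * b) :
    ∃ s ≤ 3, (r + s < 2 * a + 3 * j + 2 * b) ∧ (r + s < 2 * a ∧ (r + s) % 2 = 0 ∨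
      2 * a ≤ r + s ∧ r + s < 2 * a + 3 * j ∧ (r + s - 2 * a) % 3 = 2 ∨
      2 * a + 3 * j ≤ r + s ∧ (r + s - 2 * a - 3 * j) % 2 = 1) := by
  rcases lt_or_ge r (2 * a) with h | h
  · rcases Nat.even_or_odd' r with ⟨p, rfl | rfl⟩
    · exact ⟨0, by omega, by omega, Or.inl (by omega)⟩
    · rcases lt_or_ge (2 * p + 2) (2 * a) with h' | h'
      · exact ⟨1, by omega, by omega, Or.inl (by omega)⟩
      · obtain rfl : a = p + 1 := by omega
        exact ⟨3, by omega, by omega, Or.inr (Or.inl (by omega))⟩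
  · obtain ⟨u, rfl⟩ := Nat.exists_eq_add_of_le h
    rcases lt_or_ge u (3 * j) with h' | h'
    · refine ⟨2 - u % 3, by omega, ?_⟩
      have e : (u + (2 - u % 3)) % 3 = 2 := by omega
      have l : u + (2 - u % 3) < 3 * j := by omega
      generalize 2 - u % 3 = s at e l
      rw [show 2 * a + u + s - 2 * a = u + s by omega]
      exact ⟨by omega, Or.inr (Or.inl ⟨by omega, by omega, e⟩)⟩
    · obtain ⟨v, rfl⟩ := Nat.exists_eq_add_of_le h'
      refine ⟨1 - v % 2, by omega, ?_⟩
      have e : (v + (1 - v % 2)) % 2 = 1 := by omega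
      have l : v + (1 - v % 2) < 2 * b := by omega
      generalize 1 - v % 2 = s at e l
      rw [show 2 * a + (3 * j + v) + s - 2 * a - 3 * j = v + s by omega]
      exact ⟨by omega, Or.inr (Or.inr ⟨by omega, e⟩)⟩

/-- The properties of the letter sequence that are used to exclude nonperiodic solutions. -/
structure Admissible (T : ℤ → Bool) (N : ℤ) : Prop where
  uniq : ∀ i j, T i = false → T (i + 1) = false → T j = false → T (j + 1) = false → N ∣ j - i
  no_xxxx : ∀ k, T k = true → T (k + 1) = true → T (k + 2) = true → T (k + 3) = false
  no_yyxx : ∀ k, T k = false → T (k + 1) = false → T (k + 2) = true → T (k + 3) = false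
  no_xxyy : ∀ k, T k = true → T (k + 1) = true → T (k + 2) = false → T (k + 3) = true
  no_yyxyy : ∀ k, T k = false → T (k + 1) = false → T (k + 2) = true → T (k + 3) = false →
    T (k + 4) = true
  no_yyy : ∀ k, T k = false → T (k + 1) = false → T (k + 2) = true
  exists_yxyyx : ∃ i, T i = false ∧ T (i + 1) = true ∧ T (i + 2) = false ∧ T (i + 3) = false ∧
    T (i + 4) = true
  exists_xxx : ∃ i, T i = true ∧ T (i + 1) = true ∧ T (i + 2) = true

theorem admissible_pattern {a j b : ℕ} (ha : 2 ≤ a) (hj : 1 ≤ j) (hb : 2 ≤ b) :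
    Admissible (per (pattern a j b)) (pattern a j b).length := by
  have hN := length_pattern a j b
  rw [hN]
  have ev : ∀ r : ℕ, r < 2 * a + 3 * j + 2 * b → ∀ k : ℤ,
      ((2 * a + 3 * j + 2 * b : ℕ) : ℤ) ∣ k - r → (per (pattern a j b) k = false ↔
      r < 2 * a ∧ r % 2 = 0 ∨ 2 * a ≤ r ∧ r < 2 * a + 3 * j ∧ (r - 2 * a) % 3 = 2 ∨
      2 * a + 3 * j ≤ r ∧ (r - 2 * a - 3 * j) % 2 = 1) := by
    rintro r hr k ⟨e, he⟩
    rw [← per_pattern a j b e hr, ← he, add_sub_cancel]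
  have ev₁ : ∀ k : ℤ, ((2 * a + 3 * j + 2 * b : ℕ) : ℤ) ∣ k + 1 →
      per (pattern a j b) (k - 2) = false ∧ per (pattern a j b) (k - 1) = true ∧
      per (pattern a j b) k = false ∧ per (pattern a j b) (k + 1) = false ∧
      per (pattern a j b) (k + 2) = true ∧ per (pattern a j b) (k + 3) = false ∧
      per (pattern a j b) (k + 4) = true := by
    intro k hk
    have hk' : ∀ s : ℤ, ((2 * a + 3 * j + 2 * b : ℕ) : ℤ) ∣
        k + 1 - s - ((2 * a + 3 * j + 2 * b : ℕ) - s) := fun s => by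
      rw [sub_sub_sub_cancel_right]; exact dvd_sub hk dvd_rfl
    have hk'' : ∀ s : ℤ, ((2 * a + 3 * j + 2 * b : ℕ) : ℤ) ∣ k + 1 + s - s := fun s => by
      rwa [add_sub_cancel_right]
    have f₃ := ev (2 * a + 3 * j + 2 * b - 3) (by omega) (k - 2) (by
      convert hk' 3 using 1; push_cast [show 3 ≤ 2 * a + 3 * j + 2 * b by omega]; ring)
    have f₂ := ev (2 * a + 3 * j + 2 * b - 2) (by omega) (k - 1) (by
      convert hk' 2 using 1; push_cast [show 2 ≤ 2 * a + 3 * j + 2 * b by omega]; ring)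
    have f₁ := ev (2 * a + 3 * j + 2 * b - 1) (by omega) k (by
      convert hk' 1 using 1; push_cast [show 1 ≤ 2 * a + 3 * j + 2 * b by omega]; ring)
    have g₀ := ev 0 (by omega) (k + 1) (by convert hk'' 0 using 1; push_cast; ring)
    have g₁ := ev 1 (by omega) (k + 2) (by convert hk'' 1 using 1; push_cast; ring)
    have g₂ := ev 2 (by omega) (k + 3) (by convert hk'' 2 using 1; push_cast; ring)
    have g₃ := ev 3 (by omega) (k + 4) (by convert hk'' 3 using 1; push_cast; ring)
    obtain ⟨b, rfl⟩ := Nat.exists_eq_add_of_le' hb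
    rw [show 2 * a + 3 * j + 2 * (b + 2) - 3 = 2 * a + 3 * j + 2 * b + 1 by omega,
      show 2 * a + 3 * j + 2 * b + 1 - 2 * a - 3 * j = 2 * b + 1 by omega,
      show (2 * b + 1) % 2 = 1 by omega] at f₃
    rw [show 2 * a + 3 * j + 2 * (b + 2) - 2 = 2 * a + 3 * j + 2 * b + 2 by omega,
      show 2 * a + 3 * j + 2 * b + 2 - 2 * a - 3 * j = 2 * b + 2 by omega,
      show (2 * b + 2) % 2 = 0 by omega] at f₂
    rw [show 2 * a + 3 * j + 2 * (b + 2) - 1 = 2 * a + 3 * j + 2 * b + 3 by omega,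
      show 2 * a + 3 * j + 2 * b + 3 - 2 * a - 3 * j = 2 * b + 3 by omega,
      show (2 * b + 3) % 2 = 1 by omega] at f₁
    refine ⟨f₃.2 (Or.inr (Or.inr ⟨by omega, rfl⟩)), ?_, f₁.2 (Or.inr (Or.inr ⟨by omega, rfl⟩)),
      g₀.2 (Or.inl ⟨by omega, rfl⟩), ?_, g₂.2 (Or.inl ⟨by omega, rfl⟩), ?_⟩ <;>
    rw [← Bool.not_eq_false] <;> simp only [f₂, g₁, g₃] <;> omega
  refine ⟨?_, ?_, ?_, ?_, ?_, ?_, ?_, ?_⟩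
  · intro i k h₁ h₂ h₃ h₄
    have := dvd_sub (dvd_of_per_pattern hb h₃ h₄) (dvd_of_per_pattern hb h₁ h₂)
    rwa [add_sub_add_right_eq_sub] at this
  · intro k h₀ h₁ h₂
    by_contra h₃
    obtain ⟨q, r, hr, rfl⟩ := exists_mul_add (N := 2 * a + 3 * j + 2 * b) (by omega) k
    obtain ⟨s, hs, hlt, hF⟩ := exists_pattern_false hj hr
    have := (ev (r + s) hlt ((2 * a + 3 * j + 2 * b : ℕ) * q + r + s)
      ⟨q, by push_cast; ring⟩).2 hF
    interval_cases s <;> simp_all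
  · intro k h₀ h₁ _
    exact (ev₁ k (dvd_of_per_pattern hb h₀ h₁)).2.2.2.2.2.1
  · intro k h₀ h₁ h₂
    by_contra h₃
    have := ev₁ (k + 2) (dvd_of_per_pattern hb h₂ (by simpa [add_assoc] using h₃))
    rw [add_sub_cancel_right, h₀] at this
    simp at this
  · intro k h₀ h₁ _ _
    exact (ev₁ k (dvd_of_per_pattern hb h₀ h₁)).2.2.2.2.2.2
  · intro k h₀ h₁
    exact (ev₁ k (dvd_of_per_pattern hb h₀ h₁)).2.2.2.2.1
  · obtain ⟨h₀, h₁, h₂, h₃, h₄, -⟩ := ev₁ (-1) (by simp)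
    norm_num at h₀ h₁ h₂ h₃ h₄
    exact ⟨-3, by norm_num [*]⟩
  · refine ⟨(2 * a - 1 : ℕ), ?_⟩
    have f₀ := ev (2 * a - 1) (by omega) (2 * a - 1 : ℕ) (by simp)
    have f₁ := ev (2 * a) (by omega) ((2 * a - 1 : ℕ) + 1) (by
      rw [show ((2 * a - 1 : ℕ) : ℤ) + 1 = (2 * a : ℕ) by omega]; simp)
    have f₂ := ev (2 * a + 1) (by omega) ((2 * a - 1 : ℕ) + 2) (by
      rw [show ((2 * a - 1 : ℕ) : ℤ) + 2 = (2 * a + 1 : ℕ) by omega]; simp)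
    simp only [← Bool.not_eq_false, f₀, f₁, f₂]
    refine ⟨?_, ?_, ?_⟩ <;> omega

/-- The substitution `x ↦ x^t`, `y ↦ y^r` on letters. -/
def powBlk (t r : ℕ) : Bool → List Bool := blk (List.replicate t true) (List.replicate r false)

theorem flatMap_powBlk (t r : ℕ) (x y : List A) (w : List Bool) :
    (w.flatMap (powBlk t r)).flatMap (blk x y) = w.flatMap (blk (rep t x) (rep r y)) := by
  rw [List.flatMap_assoc]
  congr 1
  ext1 b
  cases b
  · exact (rep_eq_flatMap_false r x y).symm
  · exact (rep_eq_flatMap_true t x y).symm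

theorem powBlk_eq (t r : ℕ) (b : Bool) :
    powBlk t r b = List.replicate (powBlk t r b).length b := by
  cases b <;> simp [powBlk, blk]

theorem Occ.replicate {c : ℤ → A} {n : ℕ} {b : A} {p q : ℤ} (h : Occ c (List.replicate n b) p)
    (h₁ : p ≤ q) (h₂ : q < p + n) : c q = b := by
  have e : slice (fun _ => b) p (p + n) = List.replicate n b := by simp [slice]
  unfold Occ at h
  rw [List.length_replicate, ← e, slice_eq_iff _ _ rfl] at h
  simpa using h (q - p) (by omega) (by omega)

section Level

variable {c T : ℤ → Bool} {pos : ℤ → ℤ} {t r : ℕ} {N : ℤ}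

theorem Parse.eq_of_mem (P : Parse c (powBlk t r) T pos) {k q : ℤ} (h₁ : pos k ≤ q)
    (h₂ : q < pos (k + 1)) : c q = T k := by
  have h := P.occ k
  rw [powBlk_eq] at h
  exact h.replicate h₁ (by rwa [P.step] at h₂)

theorem Parse.eq_of_run (P : Parse c (powBlk t r) T pos) {b : Bool} {k : ℤ} {j : ℕ}
    (h : ∀ m, k ≤ m → m < k + j → T m = b) {q : ℤ} (h₁ : pos k ≤ q)
    (h₂ : q < pos k + j * (powBlk t r b).length) : c q = b := by
  obtain ⟨i, hi₁, hi₂⟩ := P.locate q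
  rw [← P.pos_run h] at h₂
  have l₁ := P.strictMono.lt_iff_lt.1 (h₁.trans_lt hi₂)
  have l₂ := P.strictMono.lt_iff_lt.1 (hi₁.trans_lt h₂)
  rw [P.eq_of_mem hi₁ hi₂, h i (by omega) l₂]

theorem Parse.exists_true_run (P : Parse c (powBlk t r) T pos) (H : Admissible T N) :
    ∃ i : ℤ, ∀ m, i ≤ m → m < i + (3 * t : ℕ) → c m = true := by
  obtain ⟨i, h₀, h₁, h₂⟩ := H.exists_xxx
  refine ⟨pos i, fun m hm₁ hm₂ => P.eq_of_run (k := i) (j := 3) (fun k hk₁ hk₂ => ?_) hm₁ ?_⟩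
  · obtain rfl | rfl | rfl : k = i ∨ k = i + 1 ∨ k = i + 2 := by omega
    all_goals assumption
  · simpa [powBlk, blk] using hm₂

theorem Parse.exists_false_run (P : Parse c (powBlk t r) T pos) (H : Admissible T N) :
    ∃ i : ℤ, ∀ m, i ≤ m → m < i + (2 * r : ℕ) → c m = false := by
  obtain ⟨i, -, -, h₂, h₃, -⟩ := H.exists_yxyyx
  refine ⟨pos (i + 2), fun m hm₁ hm₂ =>
    P.eq_of_run (k := i + 2) (j := 2) (fun k hk₁ hk₂ => ?_) hm₁ ?_⟩
  · obtain rfl | rfl : k = i + 2 ∨ k = i + 3 := by omega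
    all_goals assumption
  · simpa [powBlk, blk] using hm₂

theorem Parse.exists_true_false (P : Parse c (powBlk t r) T pos) (H : Admissible T N) :
    ∃ i, c i = true ∧ c (i + 1) = false := by
  obtain ⟨i, -, h₁, h₂, -⟩ := H.exists_yxyyx
  have s₁ := P.pos_lt_succ (i + 1)
  have s₂ := P.pos_lt_succ (i + 2)
  rw [show i + 1 + 1 = i + 2 by ring] at s₁
  refine ⟨pos (i + 2) - 1, ?_, ?_⟩
  · rw [P.eq_of_mem (k := i + 1) (by omega) (by rw [add_assoc]; norm_num), h₁]
  · rw [P.eq_of_mem (k := i + 2) (by omega) (by omega), h₂]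

theorem Parse.no_false_cube (P : Parse c (powBlk t 1) T pos) (H : Admissible T N) {q : ℤ}
    (h₀ : c q = false) (h₁ : c (q + 1) = false) : c (q + 2) = true := by
  obtain ⟨k, hk₁, hk₂⟩ := P.locate q
  have e₀ := P.eq_of_mem hk₁ hk₂
  have s₀ := P.step k
  rw [← e₀, h₀] at s₀
  simp only [powBlk, blk, List.length_replicate] at s₀
  have e₁ := P.eq_of_mem (k := k + 1) (q := q + 1) (by omega)
    (by have := P.pos_lt_succ (k + 1); omega)
  have s₁ := P.step (k + 1)
  rw [← e₁, h₁] at s₁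
  simp only [powBlk, blk, List.length_replicate] at s₁
  rw [show k + 1 + 1 = k + 2 by ring] at s₁
  rw [P.eq_of_mem (k := k + 2) (by omega) (by have := P.pos_lt_succ (k + 2); omega)]
  exact H.no_yyy k (e₀.symm.trans h₀) (e₁.symm.trans h₁)

theorem Parse.exists_dvd_of_period (P : Parse c (powBlk t r) T pos) (H : Admissible T N) {d : ℤ}
    (hd : ∀ q, c (q + d) = c q) : ∃ i j, N ∣ j - i ∧ pos j = pos i + d := by
  obtain ⟨i, -, h₁, h₂, h₃, -⟩ := H.exists_yxyyx
  have s₁ := P.pos_lt_succ (i + 1)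
  have s₂ := P.pos_lt_succ (i + 2)
  have s₃ := P.pos_lt_succ (i + 3)
  have e₂ := P.step (i + 2)
  rw [add_assoc] at s₁ s₂ s₃ e₂
  norm_num at s₁ s₂ s₃ e₂
  obtain ⟨j, hj₁, hj₂⟩ := P.locate (pos (i + 2) - 1 + d)
  have t₀ := P.eq_of_mem hj₁ hj₂
  rw [hd, P.eq_of_mem (k := i + 1) (by omega) (by rw [add_assoc]; norm_num), h₁] at t₀
  have f₀ : c (pos (i + 2) + d) = false := by
    rw [hd, P.eq_of_mem le_rfl (P.pos_lt_succ _), h₂]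
  have e : pos (j + 1) = pos (i + 2) + d := by
    by_contra hne
    have := P.eq_of_mem (k := j) (q := pos (i + 2) + d) (by omega) (by omega)
    rw [f₀, ← t₀] at this
    simp at this
  have f₁ : T (j + 1) = false := by
    rw [← P.eq_of_mem le_rfl (P.pos_lt_succ _), e, f₀]
  have e' := P.step (j + 1)
  rw [f₁, e] at e'
  rw [h₂] at e₂
  have f₂ : T (j + 1 + 1) = false := by
    rw [← P.eq_of_mem le_rfl (P.pos_lt_succ _),
      show pos (j + 1 + 1) = pos (i + 3) + d by omega, hd, P.eq_of_mem le_rfl (P.pos_lt_succ _), h₃]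
  exact ⟨i + 2, j + 1, H.uniq _ _ h₂ (by rw [add_assoc]; exact h₃) f₁ f₂, e⟩

end Level

theorem comm_of_pattern {x y z : List A} {a j b m : ℕ} (ha : 2 ≤ a) (hj : 1 ≤ j) (hb : 2 ≤ b)
    (hm : 2 ≤ m) (h : (pattern a j b).flatMap (blk x y) = rep m z) : x ++ y = y ++ x := by
  by_contra hne
  have H := admissible_pattern ha hj hb
  have hw : pattern a j b ≠ [] := by
    rw [← List.length_pos_iff, length_pattern]; omega
  generalize pattern a j b = w at *
  obtain ⟨ρ, t, ht, hρ, rfl⟩ := exists_prim_root (u := x) (by rintro rfl; simp at hne)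
  obtain ⟨σ, r, hr, hσ, rfl⟩ := exists_prim_root (u := y) (by rintro rfl; simp at hne)
  have hne' : ρ ++ σ ≠ σ ++ ρ := fun hc => hne (comm_rep (comm_rep hc.symm r).symm t)
  have P : Parse (per (w.flatMap (powBlk t r))) (powBlk t r) (per w) _ :=
    parse_per (by rintro (_ | _) <;> simp [powBlk, blk] <;> omega) hw
  have hw' : w.flatMap (powBlk t r) ≠ [] := by
    intro h₀
    have e := flatMap_powBlk t r ρ σ w
    obtain ⟨b, l, rfl⟩ := List.exists_cons_of_ne_nil hw
    rw [List.flatMap_cons, List.append_eq_nil_iff] at h₀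
    exact P.ne b h₀.1
  obtain ⟨c, pos, n, D⟩ := exists_dblParse hm hw' ((flatMap_powBlk t r ρ σ w).trans h) hne'
    fun d hd => by
      obtain ⟨i, k, ⟨e, he⟩, hk⟩ := P.exists_dvd_of_period H hd
      have := blockPos_add_mul (powBlk t r) hw i e
      rw [← he, add_sub_cancel, hk] at this
      exact ⟨e, add_left_cancel this⟩
  obtain ⟨i, hi⟩ := P.exists_true_run H
  obtain ⟨k, hk⟩ := P.exists_false_run H
  rcases lt_trichotomy σ.length ρ.length with hlt | heq | hlt
  · exact D.false_of_cube (b := true) hlt hρ hne' (hi i (by omega) (by omega))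
      (hi (i + 1) (by omega) (by omega)) (hi (i + 2) (by omega) (by omega))
  · exact D.false_of_length_eq heq.symm hρ hσ
      ⟨i, hi i (by omega) (by omega), hi (i + 1) (by omega) (by omega)⟩
      ⟨k, hk k (by omega) (by omega), hk (k + 1) (by omega) (by omega)⟩
      (P.exists_true_false H)
  rcases hr.eq_or_lt with rfl | hr
  · rcases lt_or_ge (rep t ρ).length (rep 1 σ).length with hlt' | hge
    · obtain ⟨c, pos, n, D'⟩ := exists_dblParse hm hw h hne fun d hd => by
        obtain ⟨l, -, -, h₂, h₃, -⟩ := H.exists_yxyyx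
        have := H.uniq (l + 2) (l + 2 + d) h₂ (by rw [add_assoc]; exact h₃) (by rw [hd, h₂])
          (by rw [add_right_comm, hd, add_assoc]; exact h₃)
        rwa [add_sub_cancel_left] at this
      obtain ⟨l, h₀, h₁, h₂, h₃, h₄⟩ := H.exists_yxyyx
      exact D'.false_of_pattern (by simpa [blk] using hσ) hne hlt' H.no_xxxx H.no_yyxx H.no_xxyy
        H.no_yyxyy h₀ h₁ h₂ h₃ h₄
    · rw [length_rep, length_rep, one_mul] at hge
      have ht₂ : 2 ≤ t := by
        by_contra hlt'
        obtain rfl : t = 1 := by omega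
        omega
      exact D.false_of_long_run hρ ht₂ hge (fun q => P.no_false_cube H) hi
  · exact D.false_of_cube (b := false) hlt hσ hne'.symm (hk k (by omega) (by omega))
      (hk (k + 1) (by omega) (by omega)) (hk (k + 2) (by omega) (by omega))

theorem ofList_rep (k : ℕ) (u : List A) :
    FreeMonoid.ofList (rep k u) = FreeMonoid.ofList u ^ k := by
  induction k with
  | zero => rfl
  | succ k ih => rw [rep_succ, FreeMonoid.ofList_append, ih, pow_succ']

theorem flatMap_pattern (a j b : ℕ) (x y : List A) : (pattern a j b).flatMap (blk x y) =
    rep a (y ++ x) ++ rep j (x ++ x ++ y) ++ rep b (x ++ y) := by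
  have e : ∀ (k : ℕ) (u : List Bool), (rep k u).flatMap (blk x y) = rep k (u.flatMap (blk x y)) := by
    intro k u
    induction k with
    | zero => rfl
    | succ k ih => rw [rep_succ, rep_succ, List.flatMap_append, ih]
  rw [pattern, List.flatMap_append, List.flatMap_append, e, e, e]
  simp [blk]

end WordPower

/-- The equation `(yx)^i yx (xxy)^j xy (xy)^k = z^m` with `i, j, k ≥ 1` and `m ≥ 2`
has only periodic solutions: `x, y, z` pairwise commute. -/
theorem stmt10 {A : Type*} (x y z : FreeMonoid A) (i j k m : ℕ)
    (hi : 1 ≤ i) (hj : 1 ≤ j) (hk : 1 ≤ k) (hm : 2 ≤ m)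
    (heq : (y * x) ^ i * (y * x) * (x * x * y) ^ j * (x * y) * (x * y) ^ k = z ^ m) :
    x * y = y * x ∧ x * z = z * x ∧ y * z = z * y := by
  have hxy : Commute x y := by
    refine WordPower.comm_of_pattern (a := i + 1) (b := k + 1) (x := x.toList) (y := y.toList)
      (z := z.toList) (by omega) hj (by omega) hm (FreeMonoid.ofList.injective ?_)
    rw [WordPower.flatMap_pattern]
    simp only [FreeMonoid.ofList_append, WordPower.ofList_rep, FreeMonoid.ofList_toList]
    rw [← heq, pow_succ, pow_succ' (x * y) k]
    simp only [mul_assoc]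
  have hz : ∀ v : FreeMonoid A, Commute x v → Commute y v → Commute z v := by
    intro v hx hy
    have h : Commute (z ^ m) v := by
      rw [← heq]
      have hxy' := hx.mul_left hy
      have hyx' := hy.mul_left hx
      exact ((((hyx'.pow_left i).mul_left hyx').mul_left
        (((hx.mul_left hx).mul_left hy).pow_left j)).mul_left hxy').mul_left (hxy'.pow_left k)
    refine WordPower.comm_of_comm_rep (u := z.toList) (v := v.toList) (k := m) (by omega)
      (FreeMonoid.ofList.injective ?_)
    simpa only [FreeMonoid.ofList_append, WordPower.ofList_rep, FreeMonoid.ofList_toList] using h.eq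
  exact ⟨hxy, (hz x rfl hxy.symm).symm, (hz y hxy rfl).symm⟩
end

section
/- Let u, v, z be words over an alphabet A with v nonempty, such that z is a suffix of v and uv is a prefix of z·v^i for some integer i ≥ 1. Then uv = z·p_v^n for some n ≥ 0, where p_v is the primitive root of v. -/
/-- `r` is the primitive root of `w`: the shortest word whose power `w` is. -/
def IsPrimitiveRootOf {A : Type*} (r w : FreeMonoid A) : Prop :=
  (∃ k : ℕ, 1 ≤ k ∧ w = r ^ k) ∧
    ∀ r' : FreeMonoid A, (∃ k : ℕ, 1 ≤ k ∧ w = r' ^ k) → r.length ≤ r'.length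

theorem FreeMonoid.mul_inj_of_length_eq {A : Type*} {a b c d : FreeMonoid A}
    (h : a * b = c * d) (hl : a.length = c.length) : a = c ∧ b = d :=
  List.append_inj h hl

theorem FreeMonoid.exists_eq_mul_of_length_le {A : Type*} {a b c d : FreeMonoid A}
    (h : a * b = c * d) (hl : a.length ≤ c.length) : ∃ e, c = a * e ∧ b = e * d := by
  obtain ⟨e, hc, hb⟩ | ⟨e, ha, hd⟩ := List.append_eq_append_iff.mp h
  · exact ⟨e, hc, hb⟩
  · have ha' : a = c * FreeMonoid.ofList e := ha
    have hlen := congrArg FreeMonoid.length ha'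
    rw [FreeMonoid.length_mul] at hlen
    have he : FreeMonoid.ofList e = 1 := FreeMonoid.length_eq_zero.mp (by omega)
    have hd' : d = FreeMonoid.ofList e * b := hd
    refine ⟨1, ?_, ?_⟩
    · rw [ha', he, mul_one, mul_one]
    · rw [hd', he, one_mul, one_mul]

/-- Two commuting words are powers of a common word. -/
theorem FreeMonoid.exists_pow_eq_of_commute {A : Type*} (a b : FreeMonoid A)
    (h : a * b = b * a) : ∃ (r : FreeMonoid A) (m n : ℕ), a = r ^ m ∧ b = r ^ n := by
  induction hN : a.length + b.length using Nat.strong_induction_on generalizing a b with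
  | _ N ih =>
    wlog hle : a.length ≤ b.length generalizing a b
    · obtain ⟨r, m, n, hb, ha⟩ := this b a h.symm (by omega) (by omega)
      exact ⟨r, n, m, ha, hb⟩
    by_cases ha : a = 1
    · exact ⟨b, 0, 1, by simp [ha], by simp⟩
    have hpos : a.length ≠ 0 := fun h0 => ha (FreeMonoid.length_eq_zero.mp h0)
    obtain ⟨e, hbe, hbe'⟩ := FreeMonoid.exists_eq_mul_of_length_le h hle
    have hlen := congrArg FreeMonoid.length hbe
    rw [FreeMonoid.length_mul] at hlen
    obtain ⟨r, m, n, hm, hn⟩ :=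
      ih (a.length + e.length) (by omega) a e (hbe.symm.trans hbe') rfl
    exact ⟨r, m, m + n, hm, by rw [pow_add, ← hm, ← hn, hbe]⟩

/-- Two words with a common nontrivial power commute. -/
theorem FreeMonoid.commute_of_pow_eq_pow {A : Type*} {p r : FreeMonoid A} {k m : ℕ}
    (h : p ^ (k + 1) = r ^ (m + 1)) : p * r = r * p := by
  have hpr : (p * r) * (r ^ m * p ^ k) = (r * p) * (p ^ k * r ^ m) := by
    calc (p * r) * (r ^ m * p ^ k) = p * r ^ (m + 1) * p ^ k := by
          simp only [pow_succ', mul_assoc]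
      _ = p ^ (k + 1) * p ^ (k + 1) := by
          rw [← h, ← pow_succ', ← pow_add, ← pow_add]; congr 1; omega
      _ = r ^ (m + 1) * r ^ (m + 1) := by rw [h]
      _ = r * r ^ (m + 1) * r ^ m := by
          rw [← pow_succ', ← pow_add, ← pow_add]; congr 1; omega
      _ = (r * p) * (p ^ k * r ^ m) := by
          rw [← h]; simp only [pow_succ', mul_assoc]
  refine (FreeMonoid.mul_inj_of_length_eq hpr ?_).1
  rw [FreeMonoid.length_mul, FreeMonoid.length_mul, add_comm]

/-- A word commuting with a nonempty word is a power of its primitive root. -/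
theorem IsPrimitiveRootOf.exists_eq_pow_of_commute {A : Type*} {p v w : FreeMonoid A}
    (hp : IsPrimitiveRootOf p v) (hv : v ≠ 1) (h : v * w = w * v) : ∃ n : ℕ, w = p ^ n := by
  obtain ⟨⟨k, hk, hvk⟩, hmin⟩ := hp
  obtain ⟨r, m, n, hm, hn⟩ := FreeMonoid.exists_pow_eq_of_commute v w h
  obtain ⟨k, rfl⟩ := Nat.exists_eq_add_of_le' hk
  cases m with
  | zero => exact absurd (by simpa using hm) hv
  | succ m =>
    obtain ⟨q, a, b, ha, hb⟩ := FreeMonoid.exists_pow_eq_of_commute p r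
      (FreeMonoid.commute_of_pow_eq_pow (hvk.symm.trans hm))
    have hp1 : p ≠ 1 := fun h1 => hv (by rw [hvk, h1, one_pow])
    cases a with
    | zero => exact absurd (by simpa using ha) hp1
    | succ a =>
      have hle := hmin q ⟨(a + 1) * (k + 1), Nat.mul_pos a.succ_pos k.succ_pos, by
        rw [hvk, ha, pow_mul]⟩
      have hlen := congrArg FreeMonoid.length ha
      rw [pow_succ, FreeMonoid.length_mul] at hlen
      have h0 : q ^ a = 1 := FreeMonoid.length_eq_zero.mp (by omega)
      have hpq : p = q := by rw [ha, pow_succ, h0, one_mul]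
      exact ⟨b * n, by rw [hn, hb, hpq, pow_mul]⟩

/-- If `v` is nonempty, `z` is a suffix of `v` and `uv` is a prefix of `z v^i` for some
`i ≥ 1`, then `uv ∈ z p_v^*` where `p_v` is the primitive root of `v`. -/
theorem stmt11 {A : Type*} (u v z p : FreeMonoid A) (hv : v ≠ 1)
    (hz : ∃ t, v = t * z)
    (hpref : ∃ i : ℕ, 1 ≤ i ∧ ∃ s, z * v ^ i = u * v * s)
    (hp : IsPrimitiveRootOf p v) :
    ∃ n : ℕ, u * v = z * p ^ n := by
  obtain ⟨t, ht⟩ := hz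
  obtain ⟨i, -, s, hs⟩ := hpref
  have hlv := congrArg FreeMonoid.length ht
  rw [FreeMonoid.length_mul] at hlv
  obtain ⟨w, hw, hws⟩ := FreeMonoid.exists_eq_mul_of_length_le hs
    (by rw [FreeMonoid.length_mul]; omega)
  have hlw := congrArg FreeMonoid.length hw
  rw [FreeMonoid.length_mul, FreeMonoid.length_mul] at hlw
  have hvw : v * w = t * u * v := by
    rw [mul_assoc, hw, ← mul_assoc, ← ht]
  have hprefix : t * u * (v * s) = w * (s * v) := by
    rw [← mul_assoc, ← hvw, mul_assoc, ← hws, ← mul_assoc, ← hws, ← pow_succ, ← pow_succ']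
  have htu : t * u = w := (FreeMonoid.mul_inj_of_length_eq hprefix
    (by rw [FreeMonoid.length_mul]; omega)).1
  obtain ⟨n, hn⟩ := hp.exists_eq_pow_of_commute hv (hvw.trans (by rw [htu]))
  exact ⟨n, by rw [hw, hn]⟩
end

section
/- Let u, v, α, β be words over an alphabet A such that |u| ≥ |v|, the word αu is a prefix of v^i, and the word uβ is a suffix of v^i, for some integer i ≥ 1. Then αuβ commutes with v, i.e., (αuβ)v = v(αuβ). -/
namespace FreeMonoid

variable {A : Type*} {a b c d : FreeMonoid A}

theorem exists_eq_mul_right_of_mul_eq_mul (h : a * b = c * d) (hl : a.length ≤ c.length) :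
    ∃ w, c = a * w := by
  have h' : a.toList ++ b.toList = c.toList ++ d.toList := congrArg toList h
  obtain ⟨w, hw⟩ := List.prefix_of_prefix_length_le
    (List.prefix_append a.toList b.toList) (h' ▸ List.prefix_append c.toList d.toList) hl
  exact ⟨ofList w, toList.injective hw.symm⟩

theorem exists_eq_mul_left_of_mul_eq_mul (h : a * b = c * d) (hl : b.length ≤ d.length) :
    ∃ w, d = w * b := by
  have h' : a.toList ++ b.toList = c.toList ++ d.toList := congrArg toList h
  obtain ⟨w, hw⟩ := List.suffix_of_suffix_length_le
    (List.suffix_append a.toList b.toList) (h' ▸ List.suffix_append c.toList d.toList) hl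
  exact ⟨ofList w, toList.injective hw.symm⟩

theorem eq_of_mul_eq_mul_of_length_eq (h : a * b = c * d) (hl : a.length = c.length) :
    a = c := by
  have h' : a.toList ++ b.toList = c.toList ++ d.toList := congrArg toList h
  exact toList.injective (List.append_inj_left h' hl)

end FreeMonoid

/-- If `|u| ≥ |v|`, `αu` is a prefix of `v^i` and `uβ` is a suffix of `v^i` for some
`i ≥ 1`, then `αuβ` commutes with `v`. -/
theorem stmt13 {A : Type*} (u v α β : FreeMonoid A) (i : ℕ) (hi : 1 ≤ i)
    (hlen : v.length ≤ u.length)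
    (hpref : ∃ s, v ^ i = α * u * s) (hsuf : ∃ t, v ^ i = t * (u * β)) :
    (α * u * β) * v = v * (α * u * β) := by
  obtain ⟨s, hs⟩ := hpref
  obtain ⟨t, ht⟩ := hsuf
  have hcomm : v ^ i * v = v * v ^ i := (pow_succ v i).symm.trans (pow_succ' v i)
  have h₁ : (α * u) * (s * v) = (v * (α * u)) * s := by
    rw [← mul_assoc, ← hs, hcomm, hs]; simp only [mul_assoc]
  obtain ⟨z, hz⟩ := FreeMonoid.exists_eq_mul_right_of_mul_eq_mul h₁
    (by simp only [FreeMonoid.length_mul]; omega)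
  have h₂ : α * (u * z) = (v * α) * u := by
    simp only [← mul_assoc] at hz ⊢; exact hz.symm
  obtain ⟨w, hw⟩ := FreeMonoid.exists_eq_mul_right_of_mul_eq_mul h₂
    (by simp only [FreeMonoid.length_mul]; omega)
  have hwl : w.length = v.length := by
    have := congrArg FreeMonoid.length hw
    simp only [FreeMonoid.length_mul] at this; omega
  have h₃ : w * u = u * z := by
    rw [hw, mul_assoc] at h₂; exact (mul_left_cancel h₂).symm
  obtain ⟨b, hb⟩ := FreeMonoid.exists_eq_mul_right_of_mul_eq_mul h₃ (by omega)
  have h₄ : (v * t) * (u * β) = t * (u * β * v) := by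
    rw [mul_assoc, ← ht, ← hcomm, ht]; simp only [mul_assoc]
  obtain ⟨x, hx⟩ := FreeMonoid.exists_eq_mul_left_of_mul_eq_mul h₄
    (by simp only [FreeMonoid.length_mul]; omega)
  have hxl : x.length = w.length := by
    have := congrArg FreeMonoid.length hx
    simp only [FreeMonoid.length_mul] at this; omega
  have h₅ : x * (u * β) = w * (b * β * v) := by
    rw [← hx, mul_assoc b, ← mul_assoc w, ← hb, mul_assoc]
  have hxw : x = w := FreeMonoid.eq_of_mul_eq_mul_of_length_eq h₅ hxl
  calc α * u * β * v = α * (u * β * v) := by simp only [mul_assoc]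
    _ = (α * w) * (u * β) := by rw [hx, hxw, mul_assoc]
    _ = v * (α * u * β) := by rw [← hw]; simp only [mul_assoc]
end

section
/- Let α and β be words over an alphabet A, let k ≥ 1, and set x = α^(2k+1)(βα^k)^2, u = α, y = βα^k, and v = (α^k β)^2 (α^(3k+1) β α^k β)^k. Then x^(k+1) y^2 x^k = u^(k+1) v^2 u^k; that is, these words form a solution of the equation x^i y^2 x^k = u^i v^2 u^k with i = k + 1 (which is non-periodic whenever α and β do not commute). -/
/-- For any words `α, β` and `k ≥ 1`, the words `x = α^(2k+1)(βα^k)^2`, `u = α`,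
`y = βα^k` and `v = (α^k β)^2 (α^(3k+1) β α^k β)^k` satisfy
`x^(k+1) y^2 x^k = u^(k+1) v^2 u^k`. -/
theorem stmt16 {A : Type*} (α β : FreeMonoid A) (k : ℕ) (hk : 1 ≤ k) :
    (α ^ (2 * k + 1) * (β * α ^ k) ^ 2) ^ (k + 1) * (β * α ^ k) ^ 2 *
        (α ^ (2 * k + 1) * (β * α ^ k) ^ 2) ^ k =
      α ^ (k + 1) * ((α ^ k * β) ^ 2 * (α ^ (3 * k + 1) * β * α ^ k * β) ^ k) ^ 2 *
        α ^ k := by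
  have hs : SemiconjBy (α ^ k) (α ^ (2 * k + 1) * (β * α ^ k) ^ 2)
      (α ^ (3 * k + 1) * β * α ^ k * β) := by
    have h3 : α ^ (3 * k + 1) = α ^ k * α ^ (2 * k + 1) := by
      rw [← pow_add]; congr 1; omega
    simp only [SemiconjBy, h3, pow_two, mul_assoc]
  have hx : α ^ (2 * k + 1) * (β * α ^ k) ^ 2 =
      α ^ (k + 1) * (α ^ k * β * α ^ k * β) * α ^ k := by
    have h2 : α ^ (2 * k + 1) = α ^ (k + 1) * α ^ k := by
      rw [← pow_add]; congr 1; omega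
    simp only [h2, pow_two, mul_assoc]
  have hk' := (hs.pow_right k).eq
  rw [pow_succ' _ k]
  nth_rewrite 1 [hx]
  generalize (α ^ (2 * k + 1) * (β * α ^ k) ^ 2) ^ k = X at *
  generalize (α ^ (3 * k + 1) * β * α ^ k * β) ^ k = Z at *
  simp only [pow_two, mul_assoc, hk']
end

section
/- Let α and γ be words over an alphabet A and let j ≥ 3 be odd. Set β = (α γ^j α)^((j−1)/2), x = αβα, u = α, y = γ, and v = α γ^j α (so that β^2 = v^(j−1)). Then x y^j x = u v^j u; that is, the equation x y^j x = u v^j u with i = k = 1 admits these (in general non-periodic) solutions. -/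
/-- For any words `α, γ` and odd `j ≥ 3`, setting `β = (αγ^j α)^((j-1)/2)`,
`x = αβα`, `u = α`, `y = γ` and `v = αγ^j α`, we have `x y^j x = u v^j u`. -/
theorem stmt17 {A : Type*} (α γ : FreeMonoid A) (j : ℕ) (hj : 3 ≤ j) (hodd : Odd j) :
    (α * (α * γ ^ j * α) ^ ((j - 1) / 2) * α) * γ ^ j *
        (α * (α * γ ^ j * α) ^ ((j - 1) / 2) * α) =
      α * (α * γ ^ j * α) ^ j * α := by
  obtain ⟨m, rfl⟩ := hodd
  have hm : (2 * m + 1 - 1) / 2 = m := by omega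
  rw [hm]
  generalize γ ^ (2 * m + 1) = g
  have hpow : (α * g * α) ^ (2 * m + 1) =
      (α * g * α) ^ m * (α * g * α) * (α * g * α) ^ m := by
    rw [← pow_succ, ← pow_add]
    congr 1
    omega
  rw [hpow]
  simp only [mul_assoc]
end
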